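/- arXiv:2605.25462 — 3 statements merged into one kernel-verified Lean document; each statement's English description precedes it below -/
import Mathlib

section
/- Let κ₀, κ₁ > 0 and let E : [0,∞) → ℝ be a twice continuously differentiable, bounded, nonnegative function satisfying the differential inequality E''(t) ≥ κ₀·E(t) − κ₁·|E'(t)| for all t ≥ 0. Then E'(t) ≤ 0 for all t ≥ 0, and E(t) ≤ E(0)·e^{−κ₂ t} for all t ≥ 0, where κ₂ := (√(κ₁² + 4κ₀) − κ₁)/2. -/
open Real

noncomputable section

/-- If `f' ≥ c * f` on `[a, b]`, then `t ↦ exp (-c t) f t` does not decrease from `a` to `b`. -/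
theorem exp_mul_le_of_mul_le_deriv {f f' : ℝ → ℝ} {a b c : ℝ} (hab : a ≤ b)
    (hf : ∀ t, HasDerivAt f (f' t) t) (h : ∀ t ∈ Set.Ioo a b, c * f t ≤ f' t) :
    Real.exp (-c * a) * f a ≤ Real.exp (-c * b) * f b := by
  have hd : ∀ t, HasDerivAt (fun t => Real.exp (-c * t) * f t)
      (Real.exp (-c * t) * (f' t - c * f t)) t := fun t => by
    have h1 : HasDerivAt (fun t : ℝ => -c * t) (-c) t := by
      simpa using (hasDerivAt_id t).const_mul (-c)
    exact (h1.exp.mul (hf t)).congr_deriv (by ring)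
  refine monotoneOn_of_deriv_nonneg (convex_Icc a b)
    (fun t _ => (hd t).continuousAt.continuousWithinAt)
    (fun t _ => (hd t).differentiableAt.differentiableWithinAt) (fun t ht => ?_)
    (Set.left_mem_Icc.2 hab) (Set.right_mem_Icc.2 hab) hab
  rw [interior_Icc] at ht
  rw [(hd t).deriv]
  exact mul_nonneg (Real.exp_pos _).le (sub_nonneg.2 (h t ht))

/-- If `f' ≥ c` on `[a, b]`, then `f b ≥ f a + c (b - a)`. -/
theorem add_mul_sub_le_of_le_deriv {f f' : ℝ → ℝ} {a b c : ℝ} (hab : a ≤ b)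
    (hf : ∀ t, HasDerivAt f (f' t) t) (h : ∀ t ∈ Set.Ioo a b, c ≤ f' t) :
    f a + c * (b - a) ≤ f b := by
  have := (convex_Icc a b).mul_sub_le_image_sub_of_le_deriv
    (fun t _ => (hf t).continuousAt.continuousWithinAt)
    (fun t _ => (hf t).differentiableAt.differentiableWithinAt) (C := c)
    (fun t ht => by
      rw [interior_Icc] at ht
      rw [(hf t).deriv]
      exact h t ht)
    a (Set.left_mem_Icc.2 hab) b (Set.right_mem_Icc.2 hab) hab
  linarith

/-- A function with `f' ≥ -c |f|` which is positive at `a` stays positive on `[a, ∞)`. -/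
theorem pos_of_neg_mul_abs_le_deriv {f f' : ℝ → ℝ} {a c : ℝ}
    (hf : ∀ t, HasDerivAt f (f' t) t) (h : ∀ t ≥ a, -c * |f t| ≤ f' t) (ha : 0 < f a)
    {b : ℝ} (hab : a ≤ b) : 0 < f b := by
  by_contra! hb
  have hcont : Continuous f := continuous_iff_continuousAt.2 fun t => (hf t).continuousAt
  have hcomp : IsCompact (Set.Icc a b ∩ {t | f t ≤ 0}) :=
    isCompact_Icc.inter_right (isClosed_le hcont continuous_const)
  obtain ⟨s, ⟨hs, hs0⟩, hmin⟩ := hcomp.exists_isLeast ⟨b, ⟨hab, le_rfl⟩, hb⟩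
  have key := exp_mul_le_of_mul_le_deriv (c := -c) hs.1 hf fun t ht => by
    have hpos : 0 < f t := by
      by_contra! hle
      exact absurd (hmin ⟨⟨ht.1.le, ht.2.le.trans hs.2⟩, hle⟩) (not_le.2 ht.2)
    simpa [abs_of_pos hpos] using h t ht.1.le
  have h1 : 0 < Real.exp (- -c * a) * f a := mul_pos (Real.exp_pos _) ha
  have h2 : Real.exp (- -c * s) * f s ≤ 0 :=
    mul_nonpos_of_nonneg_of_nonpos (Real.exp_pos _).le hs0
  linarith

/-- ODE comparison lemma: a bounded nonnegative `C²` function on `[0,∞)` satisfying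
`E'' ≥ κ₀E − κ₁|E'|` is nonincreasing and decays exponentially at rate
`κ₂ = (√(κ₁² + 4κ₀) − κ₁)/2`. -/
theorem stmt3 (κ₀ κ₁ : ℝ) (hκ₀ : 0 < κ₀) (hκ₁ : 0 < κ₁)
    (E : ℝ → ℝ) (hreg : ContDiff ℝ 2 E)
    (hbd : ∃ M : ℝ, ∀ t ≥ (0:ℝ), E t ≤ M)
    (hnn : ∀ t ≥ (0:ℝ), 0 ≤ E t)
    (hineq : ∀ t ≥ (0:ℝ), κ₀ * E t - κ₁ * |deriv E t| ≤ deriv (deriv E) t) :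
    (∀ t ≥ (0:ℝ), deriv E t ≤ 0) ∧
    (∀ t ≥ (0:ℝ),
      E t ≤ E 0 * Real.exp (-((Real.sqrt (κ₁ ^ 2 + 4 * κ₀) - κ₁) / 2) * t)) := by
  obtain ⟨M, hM⟩ := hbd
  have hE : ∀ t, HasDerivAt E (deriv E t) t := fun t =>
    (hreg.differentiable (by norm_num) t).hasDerivAt
  have hreg' : ContDiff ℝ 1 (deriv E) := by
    have : ContDiff ℝ (1 + 1) E := by simpa [one_add_one_eq_two] using hreg
    exact (contDiff_succ_iff_deriv.1 this).2.2
  have hE' : ∀ t, HasDerivAt (deriv E) (deriv (deriv E) t) t := fun t =>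
    (hreg'.differentiable (by norm_num) t).hasDerivAt
  have hmono : ∀ t ≥ (0:ℝ), deriv E t ≤ 0 := by
    intro a ha
    by_contra! hpos
    have hstay : ∀ t ≥ a, 0 < deriv E t := fun t ht =>
      pos_of_neg_mul_abs_le_deriv (c := κ₁) hE'
        (fun u hu => by
          have := hineq u (ha.trans hu)
          have := mul_nonneg hκ₀.le (hnn u (ha.trans hu))
          linarith) hpos ht
    have hstrict : E a < E (a + 1) := by
      refine strictMonoOn_of_deriv_pos (convex_Icc a (a + 1))
        (fun t _ => (hE t).continuousAt.continuousWithinAt) (fun t ht => ?_)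
        (Set.left_mem_Icc.2 (by linarith)) (Set.right_mem_Icc.2 (by linarith)) (by linarith)
      rw [interior_Icc] at ht
      exact hstay t ht.1.le
    have hc : 0 < E (a + 1) := (hnn a ha).trans_lt hstrict
    have hge : ∀ t ≥ a + 1, E (a + 1) ≤ E t := fun t ht => by
      have := add_mul_sub_le_of_le_deriv (c := 0) ht hE
        fun u hu => (hstay u (by linarith [hu.1])).le
      linarith
    have hM1 : E (a + 1) ≤ M := hM _ (by linarith)
    have hd : 0 < κ₀ * E (a + 1) := mul_pos hκ₀ hc
    -- `E' + κ₁ E` grows at least linearly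
    have hlin : ∀ t ≥ a + 1, κ₀ * E (a + 1) * (t - (a + 1)) - κ₁ * M ≤ deriv E t := by
      intro t ht
      have := add_mul_sub_le_of_le_deriv (c := κ₀ * E (a + 1)) ht
        (fun u => (hE' u).add ((hE u).const_mul κ₁)) (fun u hu => by
          have hu0 : a + 1 ≤ u := hu.1.le
          have h1 := hineq u (by linarith)
          rw [abs_of_pos (hstay u (by linarith))] at h1
          have h2 := mul_le_mul_of_nonneg_left (hge u hu0) hκ₀.le
          linarith)
      simp only [Pi.add_apply] at this
      have h1 := hstay (a + 1) (by linarith)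
      have h2 := mul_pos hκ₁ hc
      have h3 := mul_le_mul_of_nonneg_left (hM t (by linarith)) hκ₁.le
      linarith
    obtain ⟨T, hT⟩ : ∃ T, T = a + 1 + (κ₁ * M + 1) / (κ₀ * E (a + 1)) := ⟨_, rfl⟩
    have hMpos : 0 < M := hc.trans_le hM1
    have hTa : a + 1 ≤ T := by
      have : 0 ≤ (κ₁ * M + 1) / (κ₀ * E (a + 1)) := by positivity
      linarith
    have hone : ∀ t ≥ T, 1 ≤ deriv E t := fun t ht => by
      have h1 := hlin t (hTa.trans ht)
      have h2 : (κ₁ * M + 1) / (κ₀ * E (a + 1)) ≤ t - (a + 1) := by linarith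
      rw [div_le_iff₀ hd] at h2
      linarith
    have h1 := add_mul_sub_le_of_le_deriv (c := 1) (by linarith : T ≤ T + M + 1) hE
      fun u hu => hone u hu.1.le
    have h2 := hM (T + M + 1) (by linarith)
    have h3 := hnn T (by linarith)
    linarith
  refine ⟨hmono, fun t ht => ?_⟩
  have hsq : Real.sqrt (κ₁ ^ 2 + 4 * κ₀) ^ 2 = κ₁ ^ 2 + 4 * κ₀ := Real.sq_sqrt (by positivity)
  have hlt : κ₁ < Real.sqrt (κ₁ ^ 2 + 4 * κ₀) := Real.lt_sqrt_of_sq_lt (by linarith)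
  obtain ⟨k, hk⟩ : ∃ k, k = (Real.sqrt (κ₁ ^ 2 + 4 * κ₀) - κ₁) / 2 := ⟨_, rfl⟩
  rw [← hk]
  have hkpos : 0 < k := by linarith
  have hroot : (k + κ₁) * k = κ₀ := by rw [hk]; linarith
  have hm : 0 < k + κ₁ := by linarith
  have hG : ∀ a ≥ (0:ℝ), deriv E a + k * E a ≤ 0 := by
    intro a ha
    by_contra! hpos
    obtain ⟨g, hg⟩ : ∃ g, g = deriv E a + k * E a := ⟨_, rfl⟩
    rw [← hg] at hpos
    have hMnn : 0 ≤ M := (hnn a ha).trans (hM a ha)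
    obtain ⟨x, hx⟩ : ∃ x, x = k * M / (g * (k + κ₁)) := ⟨_, rfl⟩
    have hx0 : 0 ≤ x := by rw [hx]; positivity
    have key := exp_mul_le_of_mul_le_deriv (c := k + κ₁) (by linarith : a ≤ a + x)
      (fun u => (hE' u).add ((hE u).const_mul k)) (fun u hu => by
        have hu0 : 0 ≤ u := ha.trans hu.1.le
        have h1 := hineq u hu0
        rw [abs_of_nonpos (hmono u hu0), ← hroot] at h1
        simp only [Pi.add_apply]
        linarith)
    simp only [Pi.add_apply] at key
    rw [← hg] at key
    have hsplit : Real.exp (-(k + κ₁) * a)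
        = Real.exp (-(k + κ₁) * (a + x)) * Real.exp ((k + κ₁) * x) := by
      rw [← Real.exp_add]; congr 1; ring
    rw [hsplit, mul_assoc] at key
    have h1 := le_of_mul_le_mul_left key (Real.exp_pos _)
    have h2 := mul_le_mul_of_nonneg_right (Real.add_one_le_exp ((k + κ₁) * x)) hpos.le
    have h3 : g * (k + κ₁) * x = k * M := by rw [hx]; field_simp
    have h4 := hmono (a + x) (by linarith)
    have h5 := mul_le_mul_of_nonneg_left (hM (a + x) (by linarith)) hkpos.le
    linarith
  have key := exp_mul_le_of_mul_le_deriv (c := -k) ht (fun u => (hE u).neg) (fun u hu => by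
    have := hG u hu.1.le
    simp only [Pi.neg_apply]
    linarith)
  simp only [Pi.neg_apply, neg_neg, mul_zero, Real.exp_zero, one_mul, mul_neg, neg_le_neg_iff]
    at key
  rw [neg_mul, Real.exp_neg, ← div_eq_mul_inv, le_div_iff₀ (Real.exp_pos _)]
  linarith
end
end

section
/- Let Λ ⊂ ℝ² be a lattice of covolume 1, let φ : ℝ² → ℝ be a smooth Λ-periodic function, and let v : [0,∞) × ℝ² → ℝ be a bounded, twice continuously differentiable, Λ-periodic solution of the Toda equation (e^v)_{ξξ} + v_{xx} + v_{yy} = 0 with v(0,·) = φ. Set φ̄ := log(⨏ e^φ). Then there exist constants C > 0 and δ > 0 such that |v(ξ,x,y) − φ̄| ≤ C·e^{−δξ} for all ξ ≥ 0 and all (x,y) ∈ ℝ². -/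
open Real MeasureTheory

noncomputable section

/-- The average of a `Λ`-periodic function over the fundamental parallelogram of the
lattice spanned by `v1, v2` (of covolume 1, so there is no Jacobian factor). -/
def sliceAvg (v1 v2 : ℝ × ℝ) (f : ℝ → ℝ → ℝ) : ℝ :=
  ∫ s in (0:ℝ)..1, ∫ t in (0:ℝ)..1, f (s * v1.1 + t * v2.1) (s * v1.2 + t * v2.2)

/-- Periodicity with respect to the lattice generated by `v1, v2`. -/
def LatticePeriodic (v1 v2 : ℝ × ℝ) (f : ℝ → ℝ → ℝ) : Prop :=
  ∀ x y : ℝ, f (x + v1.1) (y + v1.2) = f x y ∧ f (x + v2.1) (y + v2.2) = f x y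

/-- The Toda operator `(e^v)_{ξξ} + v_{xx} + v_{yy}` evaluated at `(ξ,x,y)`. -/
def todaOp (v : ℝ → ℝ → ℝ → ℝ) (ξ x y : ℝ) : ℝ :=
  deriv (deriv (fun s => Real.exp (v s x y))) ξ +
    deriv (deriv (fun x' => v ξ x' y)) x + deriv (deriv (fun y' => v ξ x y')) y

/-- A bounded, C², Λ-periodic solution of the Toda equation on `[0,∞) × ℝ²`
with boundary value `φ` (the boundary value problem BVP1). -/
def IsSolBVP1 (v1 v2 : ℝ × ℝ) (φ : ℝ → ℝ → ℝ) (v : ℝ → ℝ → ℝ → ℝ) : Prop :=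
  ContDiff ℝ 2 (fun p : ℝ × ℝ × ℝ => v p.1 p.2.1 p.2.2) ∧
  (∃ M : ℝ, ∀ ξ ≥ (0:ℝ), ∀ x y : ℝ, |v ξ x y| ≤ M) ∧
  (∀ ξ : ℝ, LatticePeriodic v1 v2 (v ξ)) ∧
  (∀ x y : ℝ, v 0 x y = φ x y) ∧
  (∀ ξ ≥ (0:ℝ), ∀ x y : ℝ, todaOp v ξ x y = 0)

/-- Lebesgue measure on the unit interval. -/
abbrev unitMeasure : Measure ℝ := volume.restrict (Set.Ioc 0 1)

instance : IsProbabilityMeasure unitMeasure := ⟨by simp [unitMeasure]⟩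

lemma Continuous.integrable_unitMeasure {f : ℝ → ℝ} (hf : Continuous f) :
    Integrable f unitMeasure := hf.integrableOn_Ioc

lemma unitMeasure_prod :
    unitMeasure.prod unitMeasure = volume.restrict (Set.Ioc (0:ℝ) 1 ×ˢ Set.Ioc (0:ℝ) 1) := by
  rw [Measure.prod_restrict]; rfl

lemma Continuous.integrable_unitMeasure_prod {f : ℝ × ℝ → ℝ} (hf : Continuous f) :
    Integrable f (unitMeasure.prod unitMeasure) := by
  rw [unitMeasure_prod]
  exact (hf.continuousOn.integrableOn_compact (isCompact_Icc.prod isCompact_Icc)).mono_set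
    (Set.prod_mono Set.Ioc_subset_Icc_self Set.Ioc_subset_Icc_self)

lemma Continuous.integral_unitMeasure_right {f : ℝ × ℝ → ℝ} (hf : Continuous f) :
    Continuous fun s => ∫ t, f (s, t) ∂unitMeasure := by
  have := intervalIntegral.continuous_parametric_intervalIntegral_of_continuous'
    (f := fun s t => f (s, t)) (μ := volume) hf 0 1
  simpa [intervalIntegral.integral_of_le zero_le_one] using this

lemma Continuous.integral_unitMeasure_left {f : ℝ × ℝ → ℝ} (hf : Continuous f) :
    Continuous fun t => ∫ s, f (s, t) ∂unitMeasure :=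
  (hf.comp continuous_swap).integral_unitMeasure_right

lemma abs_sub_le_integral_abs_deriv {f f' : ℝ → ℝ} (hf : ∀ x, HasDerivAt f (f' x) x)
    (hf' : Continuous f') {s r : ℝ} (hs : s ∈ Set.Icc (0:ℝ) 1) (hr : r ∈ Set.Icc (0:ℝ) 1) :
    |f s - f r| ≤ ∫ x, |f' x| ∂unitMeasure := by
  rw [← intervalIntegral.integral_eq_sub_of_hasDerivAt (fun x _ => hf x)
    (hf'.intervalIntegrable r s)]
  refine (intervalIntegral.norm_integral_le_integral_norm_uIoc (f := f')).trans ?_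
  refine setIntegral_mono_set hf'.abs.integrableOn_Ioc
    (Filter.Eventually.of_forall fun x => abs_nonneg _) ?_
  refine LE.le.eventuallyLE ?_
  rw [Set.uIoc]
  exact Set.Ioc_subset_Ioc (le_min hr.1 hs.1) (max_le hr.2 hs.2)

lemma sq_integral_le_integral_sq {f : ℝ → ℝ} (hf : Continuous f) :
    (∫ x, f x ∂unitMeasure) ^ 2 ≤ ∫ x, f x ^ 2 ∂unitMeasure := by
  set J := ∫ x, f x ∂unitMeasure with hJ
  have h0 : 0 ≤ ∫ x, (f x - J) ^ 2 ∂unitMeasure := integral_nonneg fun x => sq_nonneg _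
  have h1 : ∫ x, (f x - J) ^ 2 ∂unitMeasure
      = ∫ x, f x ^ 2 ∂unitMeasure - 2 * J * J + J ^ 2 := by
    have : ∀ x, (f x - J) ^ 2 = f x ^ 2 - 2 * J * f x + J ^ 2 := fun x => by ring
    simp_rw [this]
    rw [integral_add, integral_sub, integral_const_mul, ← hJ]
    · simp
    · exact (hf.pow 2).integrable_unitMeasure
    · exact (hf.integrable_unitMeasure).const_mul _
    · exact Continuous.integrable_unitMeasure (by fun_prop)
    · exact integrable_const _
  nlinarith

lemma ae_mem_Icc_unitMeasure : ∀ᵐ s ∂unitMeasure, s ∈ Set.Icc (0:ℝ) 1 :=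
  (ae_restrict_mem measurableSet_Ioc).mono fun _ h => Set.Ioc_subset_Icc_self h

lemma ae_mem_Icc_unitMeasure_prod : ∀ᵐ z ∂unitMeasure.prod unitMeasure,
    z.1 ∈ Set.Icc (0:ℝ) 1 ∧ z.2 ∈ Set.Icc (0:ℝ) 1 := by
  rw [unitMeasure_prod]
  exact (ae_restrict_mem (measurableSet_Ioc.prod measurableSet_Ioc)).mono
    fun _ h => ⟨Set.Ioc_subset_Icc_self h.1, Set.Ioc_subset_Icc_self h.2⟩

lemma abs_le_integral_abs_add {f f' : ℝ → ℝ} (hf : ∀ x, HasDerivAt f (f' x) x)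
    (hf' : Continuous f') {s : ℝ} (hs : s ∈ Set.Icc (0:ℝ) 1) :
    |f s| ≤ ∫ x, (|f x| + |f' x|) ∂unitMeasure := by
  have hfc : Continuous f := continuous_iff_continuousAt.2 fun x => (hf x).continuousAt
  rw [integral_add hfc.abs.integrable_unitMeasure hf'.abs.integrable_unitMeasure]
  have : ∫ x, (|f s| - ∫ x, |f' x| ∂unitMeasure) ∂unitMeasure ≤ ∫ x, |f x| ∂unitMeasure := by
    refine integral_mono_ae (integrable_const _) hfc.abs.integrable_unitMeasure ?_
    filter_upwards [ae_mem_Icc_unitMeasure] with r hr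
    have h1 := abs_sub_le_integral_abs_deriv hf hf' hs hr
    have h2 := abs_sub_abs_le_abs_sub (f s) (f r)
    linarith
  simp at this
  linarith

/-- A Poincaré inequality on the unit square. -/
lemma poincare_unitSquare {g gs gt : ℝ × ℝ → ℝ}
    (hs : ∀ z, HasDerivAt (fun s => g (s, z.2)) (gs z) z.1)
    (ht : ∀ z, HasDerivAt (fun t => g (z.1, t)) (gt z) z.2)
    (hg : Continuous g) (hgs : Continuous gs) (hgt : Continuous gt)
    (hmean : ∫ z, g z ∂unitMeasure.prod unitMeasure = 0) :
    ∫ z, g z ^ 2 ∂unitMeasure.prod unitMeasure ≤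
      2 * ∫ z, (gs z ^ 2 + gt z ^ 2) ∂unitMeasure.prod unitMeasure := by
  have cgs : Continuous fun z => gs z ^ 2 := hgs.pow 2
  have cgt : Continuous fun z => gt z ^ 2 := hgt.pow 2
  have key : ∀ s' ∈ Set.Icc (0:ℝ) 1, ∫ z, g z ^ 2 ∂unitMeasure.prod unitMeasure ≤
      2 * ∫ z, gs z ^ 2 ∂unitMeasure.prod unitMeasure
        + 2 * ∫ t, gt (s', t) ^ 2 ∂unitMeasure := by
    intro s' hs'
    have h0 : (0:ℝ) ∈ Set.Icc (0:ℝ) 1 := by simp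
    set a := g (s', 0)
    have hA : Continuous fun z : ℝ × ℝ => 2 * ∫ s, gs (s, z.2) ^ 2 ∂unitMeasure :=
      ((cgs.integral_unitMeasure_left).comp continuous_snd).const_mul 2
    have h1 : ∫ z, (g z - a) ^ 2 ∂unitMeasure.prod unitMeasure ≤
        ∫ z, (2 * (∫ s, gs (s, z.2) ^ 2 ∂unitMeasure) + 2 * ∫ t, gt (s', t) ^ 2 ∂unitMeasure)
          ∂unitMeasure.prod unitMeasure := by
      refine integral_mono_ae (Continuous.integrable_unitMeasure_prod (by fun_prop))
        (hA.add continuous_const).integrable_unitMeasure_prod ?_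
      filter_upwards [ae_mem_Icc_unitMeasure_prod] with z hz
      have c1 : Continuous fun s => gs (s, z.2) := by fun_prop
      have c2 : Continuous fun t => gt (s', t) := by fun_prop
      have e1 := abs_sub_le_integral_abs_deriv (f := fun s => g (s, z.2))
        (f' := fun s => gs (s, z.2)) (fun s => hs (s, z.2)) c1 hz.1 hs'
      have e2 := abs_sub_le_integral_abs_deriv (f := fun t => g (s', t))
        (f' := fun t => gt (s', t)) (fun t => ht (s', t)) c2 hz.2 h0
      have f1 := sq_integral_le_integral_sq c1.abs
      have f2 := sq_integral_le_integral_sq c2.abs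
      simp only [sq_abs] at f1 f2
      have g1 := (pow_le_pow_left₀ (abs_nonneg _) e1 2).trans f1
      have g2 := (pow_le_pow_left₀ (abs_nonneg _) e2 2).trans f2
      rw [sq_abs] at g1 g2
      have : (g z - a) ^ 2 ≤ 2 * (g z - g (s', z.2)) ^ 2 + 2 * (g (s', z.2) - a) ^ 2 := by
        nlinarith [sq_nonneg ((g z - g (s', z.2)) - (g (s', z.2) - a))]
      linarith
    have h2 : ∫ z, (g z - a) ^ 2 ∂unitMeasure.prod unitMeasure
        = ∫ z, g z ^ 2 ∂unitMeasure.prod unitMeasure + a ^ 2 := by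
      have : ∀ z, (g z - a) ^ 2 = g z ^ 2 - 2 * a * g z + a ^ 2 := fun z => by ring
      simp_rw [this]
      rw [integral_add, integral_sub, integral_const_mul, hmean]
      · simp
      · exact Continuous.integrable_unitMeasure_prod (by fun_prop)
      · exact Continuous.integrable_unitMeasure_prod (by fun_prop)
      · exact Continuous.integrable_unitMeasure_prod (by fun_prop)
      · exact integrable_const _
    have h3 : ∫ z, (2 * (∫ s, gs (s, z.2) ^ 2 ∂unitMeasure)
          + 2 * ∫ t, gt (s', t) ^ 2 ∂unitMeasure) ∂unitMeasure.prod unitMeasure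
        = 2 * ∫ z, gs z ^ 2 ∂unitMeasure.prod unitMeasure
          + 2 * ∫ t, gt (s', t) ^ 2 ∂unitMeasure := by
      rw [integral_add hA.integrable_unitMeasure_prod
        (integrable_const _), integral_const_mul,
        integral_fun_snd (fun t => ∫ s, gs (s, t) ^ 2 ∂unitMeasure),
        integral_prod_symm _ cgs.integrable_unitMeasure_prod]
      simp
    rw [h2, h3] at h1
    nlinarith [sq_nonneg a]
  have hB : Continuous fun s => ∫ t, gt (s, t) ^ 2 ∂unitMeasure :=
    cgt.integral_unitMeasure_right
  have h4 := integral_mono_ae (μ := unitMeasure) (integrable_const _)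
    (Continuous.integrable_unitMeasure (by fun_prop))
    (ae_mem_Icc_unitMeasure.mono key)
  rw [integral_add (integrable_const _) (Continuous.integrable_unitMeasure (by fun_prop)),
    integral_const_mul (2:ℝ) (fun s => ∫ t, gt (s, t) ^ 2 ∂unitMeasure),
    ← integral_prod _ cgt.integrable_unitMeasure_prod] at h4
  rw [integral_add cgs.integrable_unitMeasure_prod
    cgt.integrable_unitMeasure_prod]
  simp at h4
  linarith

/-- The embedding of `W^{1,1}` in `L²` on the unit square. -/
lemma sobolev_unitSquare {g gs gt : ℝ × ℝ → ℝ}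
    (hs : ∀ z, HasDerivAt (fun s => g (s, z.2)) (gs z) z.1)
    (ht : ∀ z, HasDerivAt (fun t => g (z.1, t)) (gt z) z.2)
    (hg : Continuous g) (hgs : Continuous gs) (hgt : Continuous gt) :
    ∫ z, g z ^ 2 ∂unitMeasure.prod unitMeasure ≤
      (∫ z, (|g z| + |gs z| + |gt z|) ∂unitMeasure.prod unitMeasure) ^ 2 := by
  have ca : Continuous fun z => |g z| + |gs z| := by fun_prop
  have cb : Continuous fun z => |g z| + |gt z| := by fun_prop
  set a : ℝ → ℝ := fun t => ∫ s, (|g (s, t)| + |gs (s, t)|) ∂unitMeasure with ha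
  set b : ℝ → ℝ := fun s => ∫ t, (|g (s, t)| + |gt (s, t)|) ∂unitMeasure with hb
  have hac : Continuous a := ca.integral_unitMeasure_left
  have hbc : Continuous b := cb.integral_unitMeasure_right
  have h1 : ∫ z, g z ^ 2 ∂unitMeasure.prod unitMeasure ≤
      ∫ z, b z.1 * a z.2 ∂unitMeasure.prod unitMeasure := by
    refine integral_mono_ae (Continuous.integrable_unitMeasure_prod (by fun_prop))
      (Continuous.integrable_unitMeasure_prod (by fun_prop)) ?_
    filter_upwards [ae_mem_Icc_unitMeasure_prod] with z hz
    have e1 := abs_le_integral_abs_add (f := fun s => g (s, z.2))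
      (f' := fun s => gs (s, z.2)) (fun s => hs (s, z.2)) (by fun_prop) hz.1
    have e2 := abs_le_integral_abs_add (f := fun t => g (z.1, t))
      (f' := fun t => gt (z.1, t)) (fun t => ht (z.1, t)) (by fun_prop) hz.2
    have := mul_le_mul e2 e1 (abs_nonneg _) ((abs_nonneg _).trans e2)
    rwa [← pow_two, sq_abs] at this
  rw [integral_prod_mul, ha, hb, ← integral_prod_symm _ ca.integrable_unitMeasure_prod,
    ← integral_prod _ cb.integrable_unitMeasure_prod] at h1
  refine h1.trans ?_
  rw [pow_two]
  refine mul_le_mul (integral_mono cb.integrable_unitMeasure_prod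
    (Continuous.integrable_unitMeasure_prod (by fun_prop)) fun z => ?_)
    (integral_mono ca.integrable_unitMeasure_prod
    (Continuous.integrable_unitMeasure_prod (by fun_prop)) fun z => ?_)
    (integral_nonneg fun z => by positivity) (integral_nonneg fun z => by positivity)
  · dsimp only; linarith [abs_nonneg (gs z)]
  · dsimp only; linarith [abs_nonneg (gt z)]

/-- A bound on all the `L^(2^k)` norms of a continuous function is a pointwise bound. -/
lemma sq_le_of_integral_pow_le {w : ℝ × ℝ → ℝ} (hw : Continuous w) {X : ℝ} (hX : 0 ≤ X)
    (h : ∀ k : ℕ, ∫ z, w z ^ (2 * 2 ^ k) ∂unitMeasure.prod unitMeasure ≤ X ^ (2 ^ k))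
    {z : ℝ × ℝ} (hz : z ∈ Set.Icc (0:ℝ) 1 ×ˢ Set.Icc (0:ℝ) 1) : w z ^ 2 ≤ X := by
  by_contra! hlt
  obtain ⟨Y, hXY, hY⟩ := exists_between hlt
  have hU : IsOpen {p | Y < w p ^ 2} := isOpen_lt continuous_const (by fun_prop)
  have hcl : z ∈ closure (Set.Ioo (0:ℝ) 1 ×ˢ Set.Ioo (0:ℝ) 1) := by
    rwa [closure_prod_eq, closure_Ioo zero_ne_one]
  have hne := mem_closure_iff.1 hcl _ hU hY
  have hpos : 0 < volume ({p | Y < w p ^ 2} ∩ Set.Ioo (0:ℝ) 1 ×ˢ Set.Ioo (0:ℝ) 1) :=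
    (hU.inter (isOpen_Ioo.prod isOpen_Ioo)).measure_pos _ hne
  have hm : 0 < (unitMeasure.prod unitMeasure).real {p | Y ≤ w p ^ 2} := by
    refine ENNReal.toReal_pos (ne_of_gt (hpos.trans_le ?_)) (measure_ne_top _ _)
    rw [unitMeasure_prod, Measure.restrict_apply (isClosed_le continuous_const
      (by fun_prop)).measurableSet]
    exact measure_mono (Set.inter_subset_inter (fun p hp => show Y ≤ w p ^ 2 from le_of_lt hp)
      (Set.prod_mono Set.Ioo_subset_Ioc_self Set.Ioo_subset_Ioc_self))
  have hY0 : 0 < Y := hX.trans_lt hXY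
  set m := (unitMeasure.prod unitMeasure).real {p | Y ≤ w p ^ 2}
  have hb : ∀ k : ℕ, m ≤ (X / Y) ^ (2 ^ k) := by
    intro k
    have h1 := mul_meas_ge_le_integral_of_nonneg (μ := unitMeasure.prod unitMeasure)
      (f := fun z => w z ^ (2 * 2 ^ k)) (Filter.Eventually.of_forall fun z => by
        dsimp only; rw [pow_mul]; positivity)
      (Continuous.integrable_unitMeasure_prod (by fun_prop)) (Y ^ (2 ^ k))
    have h2 : {p | Y ^ (2 ^ k) ≤ w p ^ (2 * 2 ^ k)} = {p | Y ≤ w p ^ 2} := by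
      ext p
      simp only [Set.mem_ofPred_eq, pow_mul]
      exact pow_le_pow_iff_left₀ hY0.le (sq_nonneg _) (by positivity)
    rw [h2] at h1
    rw [div_pow, le_div_iff₀ (by positivity), mul_comm]
    exact h1.trans (h k)
  have hlim : Filter.Tendsto (fun k : ℕ => (X / Y) ^ (2 ^ k)) Filter.atTop (nhds 0) :=
    (tendsto_pow_atTop_nhds_zero_of_lt_one (by positivity) ((div_lt_one hY0).2 hXY)).comp
      (tendsto_pow_atTop_atTop_of_one_lt one_lt_two)
  exact absurd (ge_of_tendsto' hlim hb) (not_le.2 hm)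

/-- A function that is bounded above on a half-line and has nonnegative second derivative there
is nonincreasing. -/
lemma deriv_nonpos_of_bddAbove {f f' f'' : ℝ → ℝ} (hf : ∀ x, HasDerivAt f (f' x) x)
    (hf' : ∀ x, HasDerivAt f' (f'' x) x) (h2 : ∀ x, 0 ≤ x → 0 ≤ f'' x)
    {B : ℝ} (hB : ∀ x, 0 ≤ x → f x ≤ B) {a : ℝ} (ha : 0 ≤ a) : f' a ≤ 0 := by
  by_contra! hpos
  have hmono : MonotoneOn f' (Set.Ici a) := by
    refine monotoneOn_of_hasDerivWithinAt_nonneg (convex_Ici a) (f' := f'')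
      (fun x _ => (hf' x).continuousAt.continuousWithinAt)
      (fun x _ => (hf' x).hasDerivWithinAt) fun x hx => h2 x ?_
    rw [interior_Ici] at hx
    exact ha.trans (le_of_lt hx)
  have hm2 : MonotoneOn (fun x => f x - f' a * x) (Set.Ici a) := by
    refine monotoneOn_of_hasDerivWithinAt_nonneg (convex_Ici a) (f' := fun x => f' x - f' a)
      (fun x _ => ((hf x).sub ((hasDerivAt_id x).const_mul _)).continuousAt.continuousWithinAt)
      (fun x _ => (((hf x).sub ((hasDerivAt_id x).const_mul (f' a))).congr_deriv
          (by simp)).hasDerivWithinAt)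
      fun x hx => ?_
    rw [interior_Ici] at hx
    exact sub_nonneg.2 (hmono Set.self_mem_Ici (Set.Ioi_subset_Ici_self hx) (le_of_lt hx))
  set y := a + (|B - f a| + 1) / f' a
  have hy : a ≤ y := le_add_of_nonneg_right (by positivity)
  have h3 := hm2 Set.self_mem_Ici hy hy
  have h4 : f' a * y = f' a * a + (|B - f a| + 1) := by
    simp only [y]; field_simp
  dsimp only at h3
  linarith [hB y (ha.trans hy), le_abs_self (B - f a)]

lemma antitoneOn_of_bddAbove {f f' f'' : ℝ → ℝ} (hf : ∀ x, HasDerivAt f (f' x) x)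
    (hf' : ∀ x, HasDerivAt f' (f'' x) x) (h2 : ∀ x, 0 ≤ x → 0 ≤ f'' x)
    {B : ℝ} (hB : ∀ x, 0 ≤ x → f x ≤ B) : AntitoneOn f (Set.Ici 0) := by
  refine antitoneOn_of_hasDerivWithinAt_nonpos (convex_Ici 0) (f' := f')
    (fun x _ => (hf x).continuousAt.continuousWithinAt)
    (fun x _ => (hf x).hasDerivWithinAt) fun x hx => ?_
  rw [interior_Ici] at hx
  exact deriv_nonpos_of_bddAbove hf hf' h2 hB (le_of_lt hx)

/-- Bounded nonnegative solutions of `f'' ≥ δ² f` decay exponentially. -/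
lemma le_mul_exp_of_sq_mul_le {f f' f'' : ℝ → ℝ} (hf : ∀ x, HasDerivAt f (f' x) x)
    (hf' : ∀ x, HasDerivAt f' (f'' x) x) {δ : ℝ} (hδ : 0 < δ) (h0 : ∀ x, 0 ≤ x → 0 ≤ f x)
    (h2 : ∀ x, 0 ≤ x → δ ^ 2 * f x ≤ f'' x)
    {B : ℝ} (hB : ∀ x, 0 ≤ x → f x ≤ B) {x : ℝ} (hx : 0 ≤ x) :
    f x ≤ f 0 * exp (-δ * x) := by
  have hexp : ∀ c x : ℝ, HasDerivAt (fun x => exp (c * x)) (exp (c * x) * c) x := fun c x => by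
    simpa using ((hasDerivAt_id x).const_mul c).exp
  have hneg : ∀ x, 0 ≤ x → f' x ≤ 0 := fun x hx => deriv_nonpos_of_bddAbove hf hf'
    (fun x hx => (mul_nonneg (sq_nonneg δ) (h0 x hx)).trans (h2 x hx)) hB hx
  have hK : ∀ x, HasDerivAt (fun x => (f' x + δ * f x) * exp (-δ * x))
      ((f'' x - δ ^ 2 * f x) * exp (-δ * x)) x := fun x => by
    refine (((hf' x).add ((hf x).const_mul δ)).mul (hexp (-δ) x)).congr_deriv ?_
    simp only [Pi.add_apply]
    ring
  have hKmono : MonotoneOn (fun x => (f' x + δ * f x) * exp (-δ * x)) (Set.Ici 0) := by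
    refine monotoneOn_of_hasDerivWithinAt_nonneg (convex_Ici 0)
      (fun x _ => (hK x).continuousAt.continuousWithinAt)
      (fun x _ => (hK x).hasDerivWithinAt) fun x hx => ?_
    rw [interior_Ici] at hx
    exact mul_nonneg (sub_nonneg.2 (h2 x (le_of_lt hx))) (exp_pos _).le
  have hKle : ∀ a, 0 ≤ a → f' a + δ * f a ≤ 0 := by
    intro a ha
    have hlim : Filter.Tendsto (fun x => δ * B * exp (-δ * x)) Filter.atTop (nhds 0) := by
      rw [← mul_zero (δ * B)]
      refine Filter.Tendsto.const_mul _ (tendsto_exp_atBot.comp ?_)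
      exact Filter.tendsto_id.const_mul_atTop_of_neg (neg_lt_zero.2 hδ)
    have : (f' a + δ * f a) * exp (-δ * a) ≤ 0 := by
      refine ge_of_tendsto hlim ?_
      filter_upwards [Filter.eventually_ge_atTop a] with y hy
      refine (hKmono ha (ha.trans hy) hy).trans ?_
      refine mul_le_mul_of_nonneg_right ?_ (exp_pos _).le
      have := mul_le_mul_of_nonneg_left (hB y (ha.trans hy)) hδ.le
      linarith [hneg y (ha.trans hy)]
    exact nonpos_of_mul_nonpos_left this (exp_pos _)
  have hanti : AntitoneOn (fun x => f x * exp (δ * x)) (Set.Ici 0) := by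
    refine antitoneOn_of_hasDerivWithinAt_nonpos (convex_Ici 0)
      (f' := fun x => (f' x + δ * f x) * exp (δ * x))
      (fun x _ => ((hf x).mul (hexp δ x)).continuousAt.continuousWithinAt)
      (fun x _ => (((hf x).mul (hexp δ x)).congr_deriv (by ring)).hasDerivWithinAt)
      fun x hx => ?_
    rw [interior_Ici] at hx
    exact mul_nonpos_of_nonpos_of_nonneg (hKle x (le_of_lt hx)) (exp_pos _).le
  have := hanti Set.self_mem_Ici hx hx
  simp only [mul_zero, exp_zero, mul_one] at this
  rw [neg_mul, exp_neg, ← div_eq_mul_inv, le_div_iff₀ (exp_pos _)]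
  exact this

lemma mul_sq_half_le_of_le_deriv2 {f f' f'' : ℝ → ℝ} (hf : ∀ x, HasDerivAt f (f' x) x)
    (hf' : ∀ x, HasDerivAt f' (f'' x) x) {a b Q : ℝ} (hab : a ≤ b)
    (h2 : ∀ x ∈ Set.Icc a b, Q ≤ f'' x) (hb' : f' b ≤ 0) (hb : 0 ≤ f b) :
    Q * (b - a) ^ 2 / 2 ≤ f a := by
  have d1 : ∀ x, HasDerivAt (fun x => f' x - Q * (x - b)) (f'' x - Q) x := fun x => by
    exact ((hf' x).sub (((hasDerivAt_id x).sub_const b).const_mul Q)).congr_deriv (by simp)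
  have m1 : MonotoneOn (fun x => f' x - Q * (x - b)) (Set.Icc a b) :=
    monotoneOn_of_hasDerivWithinAt_nonneg (convex_Icc a b)
      (fun x _ => (d1 x).continuousAt.continuousWithinAt)
      (fun x _ => (d1 x).hasDerivWithinAt)
      fun x hx => sub_nonneg.2 (h2 x (interior_subset hx))
  have d2 : ∀ x, HasDerivAt (fun x => f x - Q * (x - b) ^ 2 / 2) (f' x - Q * (x - b)) x :=
    fun x => by
      refine ((hf x).sub (((((hasDerivAt_id x).sub_const b).pow 2).const_mul Q).div_const
        2)).congr_deriv ?_
      simp; ring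
  have m2 : AntitoneOn (fun x => f x - Q * (x - b) ^ 2 / 2) (Set.Icc a b) :=
    antitoneOn_of_hasDerivWithinAt_nonpos (convex_Icc a b)
      (fun x _ => (d2 x).continuousAt.continuousWithinAt)
      (fun x _ => (d2 x).hasDerivWithinAt)
      fun x hx => by
        have hx' := interior_subset hx
        have := m1 hx' (Set.right_mem_Icc.2 hab) hx'.2
        simp only [sub_self, mul_zero, sub_zero] at this
        linarith
  have := m2 (Set.left_mem_Icc.2 hab) (Set.right_mem_Icc.2 hab) hab
  simp only [sub_self] at this
  nlinarith

/-- The iteration step: integrating `√u ≤ 3 f + K f''` over an interval. -/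
lemma le_mul_sq_of_le_deriv2 {f f' f'' u : ℝ → ℝ} (hf : ∀ x, HasDerivAt f (f' x) x)
    (hf' : ∀ x, HasDerivAt f' (f'' x) x) {a l K : ℝ} (hK : 0 < K) (hl : 0 < l) (hl1 : l ≤ 1)
    (hfm : ∀ x ∈ Set.Icc a (a + l), f x ≤ f a) (hd : f' (a + l) ≤ 0) (hf0 : ∀ x, 0 ≤ f x)
    (hu0 : ∀ x, 0 ≤ u x) (hum : ∀ x ∈ Set.Icc a (a + l), u (a + l) ≤ u x)
    (hpos : ∀ x ∈ Set.Icc a (a + l), 0 ≤ f'' x)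
    (h : ∀ x ∈ Set.Icc a (a + l), u x ≤ (3 * f x + K * f'' x) ^ 2) :
    u (a + l) ≤ ((3 + 2 * K) / l ^ 2) ^ 2 * f a ^ 2 := by
  set S := √(u (a + l))
  have hS : ∀ x ∈ Set.Icc a (a + l), (S - 3 * f a) / K ≤ f'' x := by
    intro x hx
    have h1 : S ≤ 3 * f x + K * f'' x := by
      rw [Real.sqrt_le_left (by nlinarith [hf0 x, mul_nonneg hK.le (hpos x hx)])]
      exact (hum x hx).trans (h x hx)
    rw [div_le_iff₀ hK]
    linarith [hfm x hx]
  have h2 := mul_sq_half_le_of_le_deriv2 hf hf' (by linarith) hS hd (hf0 _)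
  rw [add_sub_cancel_left] at h2
  have h3 : S * l ^ 2 ≤ (3 * l ^ 2 + 2 * K) * f a := by
    have : (S - 3 * f a) / K * l ^ 2 / 2 * (2 * K) = (S - 3 * f a) * l ^ 2 := by field_simp
    nlinarith [mul_le_mul_of_nonneg_right h2 (by positivity : 0 ≤ 2 * K)]
  have h4 : S ≤ (3 + 2 * K) / l ^ 2 * f a := by
    rw [div_mul_eq_mul_div, le_div_iff₀ (by positivity)]
    refine h3.trans (mul_le_mul_of_nonneg_right ?_ (hf0 a))
    have : l ^ 2 ≤ 1 := pow_le_one₀ hl.le hl1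
    linarith
  rw [← mul_pow, ← Real.sq_sqrt (hu0 (a + l))]
  exact pow_le_pow_left₀ (Real.sqrt_nonneg _) h4 2

/-- The directional derivative. -/
def dirDeriv (e : ℝ × ℝ × ℝ) (Ψ : ℝ × ℝ × ℝ → ℝ) (p : ℝ × ℝ × ℝ) : ℝ := fderiv ℝ Ψ p e

lemma ContDiff.dirDeriv_two {Ψ : ℝ × ℝ × ℝ → ℝ} (h : ContDiff ℝ 2 Ψ) (e : ℝ × ℝ × ℝ) :
    ContDiff ℝ 1 (dirDeriv e Ψ) :=
  (h.fderiv_right (m := 1) (by norm_num)).clm_apply contDiff_const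

lemma ContDiff.continuous_dirDeriv {Ψ : ℝ × ℝ × ℝ → ℝ} (h : ContDiff ℝ 1 Ψ) (e : ℝ × ℝ × ℝ) :
    Continuous (dirDeriv e Ψ) :=
  ((h.fderiv_right (m := 0) (by norm_num)).clm_apply contDiff_const).continuous

lemma ContDiff.hasDerivAt_comp_dirDeriv {Ψ : ℝ × ℝ × ℝ → ℝ} (h : ContDiff ℝ 1 Ψ)
    {c : ℝ → ℝ × ℝ × ℝ} {e : ℝ × ℝ × ℝ} {x : ℝ} (hc : HasDerivAt c e x) :
    HasDerivAt (fun s => Ψ (c s)) (dirDeriv e Ψ (c x)) x :=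
  ((h.differentiable (by norm_num)) (c x)).hasFDerivAt.comp_hasDerivAt x hc

lemma HasDerivAt.dirDeriv_comp {Ψ : ℝ × ℝ × ℝ → ℝ} {p : ℝ × ℝ × ℝ} {f : ℝ → ℝ} {f' : ℝ}
    (hf : HasDerivAt f f' (Ψ p)) (h : DifferentiableAt ℝ Ψ p) (e : ℝ × ℝ × ℝ) :
    dirDeriv e (fun p => f (Ψ p)) p = f' * dirDeriv e Ψ p := by
  have := hf.comp_hasFDerivAt p h.hasFDerivAt
  simp only [dirDeriv]
  rw [show (fun p => f (Ψ p)) = f ∘ Ψ from rfl, this.fderiv]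
  simp

lemma dirDeriv_mul {Ψ Θ : ℝ × ℝ × ℝ → ℝ} {p : ℝ × ℝ × ℝ} (h : DifferentiableAt ℝ Ψ p)
    (h' : DifferentiableAt ℝ Θ p) (e : ℝ × ℝ × ℝ) :
    dirDeriv e (fun p => Ψ p * Θ p) p = Ψ p * dirDeriv e Θ p + dirDeriv e Ψ p * Θ p := by
  simp only [dirDeriv]
  rw [fderiv_fun_mul h h']
  simp [mul_comm]

lemma dirDeriv_smul_add_smul (Ψ : ℝ × ℝ × ℝ → ℝ) (a b : ℝ) (e e' p : ℝ × ℝ × ℝ) :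
    dirDeriv (a • e + b • e') Ψ p = a * dirDeriv e Ψ p + b * dirDeriv e' Ψ p := by
  simp [dirDeriv]

/-- Translation invariance of `Ψ` under the lattice spanned by `v1, v2` in the last two
variables. -/
def SlicePeriodic (v1 v2 : ℝ × ℝ) (Ψ : ℝ × ℝ × ℝ → ℝ) : Prop :=
  Function.Periodic Ψ (0, v1) ∧ Function.Periodic Ψ (0, v2)

lemma Function.Periodic.dirDeriv {Ψ : ℝ × ℝ × ℝ → ℝ} {u : ℝ × ℝ × ℝ}
    (h : Function.Periodic Ψ u) (e : ℝ × ℝ × ℝ) : Function.Periodic (dirDeriv e Ψ) u := by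
  intro p
  simp only [_root_.dirDeriv]
  rw [← fderiv_comp_add_right, funext h]

lemma SlicePeriodic.dirDeriv {v1 v2 : ℝ × ℝ} {Ψ : ℝ × ℝ × ℝ → ℝ} (h : SlicePeriodic v1 v2 Ψ)
    (e : ℝ × ℝ × ℝ) : SlicePeriodic v1 v2 (dirDeriv e Ψ) :=
  ⟨h.1.dirDeriv e, h.2.dirDeriv e⟩

/-- The average of `Ψ (ξ, ·)` over the parallelogram spanned by `v1, v2`. -/
def latticeAvg (v1 v2 : ℝ × ℝ) (Ψ : ℝ × ℝ × ℝ → ℝ) (ξ : ℝ) : ℝ :=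
  ∫ z, Ψ (ξ, z.1 • v1 + z.2 • v2) ∂unitMeasure.prod unitMeasure

section latticeAvg

variable {v1 v2 : ℝ × ℝ} {Ψ Θ : ℝ × ℝ × ℝ → ℝ} {ξ : ℝ}

lemma Continuous.integrable_slice (h : Continuous Ψ) (v1 v2 : ℝ × ℝ) (ξ : ℝ) :
    Integrable (fun z : ℝ × ℝ => Ψ (ξ, z.1 • v1 + z.2 • v2)) (unitMeasure.prod unitMeasure) :=
  Continuous.integrable_unitMeasure_prod (by fun_prop)

lemma latticeAvg_mono (h : Continuous Ψ) (h' : Continuous Θ) (hle : ∀ p, Ψ (ξ, p) ≤ Θ (ξ, p)) :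
    latticeAvg v1 v2 Ψ ξ ≤ latticeAvg v1 v2 Θ ξ :=
  integral_mono (h.integrable_slice v1 v2 ξ) (h'.integrable_slice v1 v2 ξ) fun _ => hle _

lemma latticeAvg_nonneg (h : ∀ p, 0 ≤ Ψ (ξ, p)) : 0 ≤ latticeAvg v1 v2 Ψ ξ :=
  integral_nonneg fun _ => h _

lemma latticeAvg_add (h : Continuous Ψ) (h' : Continuous Θ) :
    latticeAvg v1 v2 (fun p => Ψ p + Θ p) ξ = latticeAvg v1 v2 Ψ ξ + latticeAvg v1 v2 Θ ξ :=
  integral_add (h.integrable_slice v1 v2 ξ) (h'.integrable_slice v1 v2 ξ)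

lemma latticeAvg_sub (h : Continuous Ψ) (h' : Continuous Θ) :
    latticeAvg v1 v2 (fun p => Ψ p - Θ p) ξ = latticeAvg v1 v2 Ψ ξ - latticeAvg v1 v2 Θ ξ :=
  integral_sub (h.integrable_slice v1 v2 ξ) (h'.integrable_slice v1 v2 ξ)

lemma latticeAvg_const_mul (c : ℝ) :
    latticeAvg v1 v2 (fun p => c * Ψ p) ξ = c * latticeAvg v1 v2 Ψ ξ :=
  integral_const_mul _ _

lemma latticeAvg_const (c : ℝ) : latticeAvg v1 v2 (fun _ => c) ξ = c := by
  simp [latticeAvg]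

lemma hasDerivAt_latticeAvg (h : ContDiff ℝ 1 Ψ) (v1 v2 : ℝ × ℝ) (ξ : ℝ) :
    HasDerivAt (latticeAvg v1 v2 Ψ) (latticeAvg v1 v2 (dirDeriv (1, 0) Ψ) ξ) ξ := by
  have hd := h.continuous_dirDeriv (1, 0)
  have hcont : Continuous fun q : ℝ × ℝ × ℝ =>
      dirDeriv (1, 0) Ψ (q.1, q.2.1 • v1 + q.2.2 • v2) := by fun_prop
  obtain ⟨B, hB⟩ := ((isCompact_Icc (a := ξ - 1) (b := ξ + 1)).prod
    ((isCompact_Icc (a := (0:ℝ)) (b := 1)).prod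
      (isCompact_Icc (a := (0:ℝ)) (b := 1)))).exists_bound_of_continuousOn hcont.continuousOn
  unfold latticeAvg
  refine (hasDerivAt_integral_of_dominated_loc_of_deriv_le (μ := unitMeasure.prod unitMeasure)
    (bound := fun _ => B)
    (s := Set.Icc (ξ - 1) (ξ + 1))
    (F := fun x z => Ψ (x, z.1 • v1 + z.2 • v2))
    (F' := fun x z => dirDeriv (1, 0) Ψ (x, z.1 • v1 + z.2 • v2))
    (Icc_mem_nhds (by linarith) (by linarith)) ?_ (h.continuous.integrable_slice v1 v2 ξ)
    (hd.integrable_slice v1 v2 ξ).aestronglyMeasurable ?_ (integrable_const _) ?_).2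
  · exact Filter.Eventually.of_forall fun x =>
      (h.continuous.integrable_slice v1 v2 x).aestronglyMeasurable
  · filter_upwards [ae_mem_Icc_unitMeasure_prod] with z hz x hx
    exact hB (x, z) (Set.mk_mem_prod hx (Set.mk_mem_prod hz.1 hz.2))
  · refine Filter.Eventually.of_forall fun z x _ => ?_
    exact h.hasDerivAt_comp_dirDeriv (c := fun x => (x, z.1 • v1 + z.2 • v2))
      ((hasDerivAt_id x).prodMk (hasDerivAt_const x _))

lemma ContDiff.hasDerivAt_slice_left (h : ContDiff ℝ 1 Ψ) (v1 v2 : ℝ × ℝ) (ξ : ℝ) (z : ℝ × ℝ) :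
    HasDerivAt (fun s : ℝ => Ψ (ξ, s • v1 + z.2 • v2))
      (dirDeriv (0, v1) Ψ (ξ, z.1 • v1 + z.2 • v2)) z.1 := by
  refine h.hasDerivAt_comp_dirDeriv (c := fun s => (ξ, s • v1 + z.2 • v2)) ?_
  refine (hasDerivAt_const _ _).prodMk ?_
  simpa using ((hasDerivAt_id z.1).smul_const v1).add_const (z.2 • v2)

lemma ContDiff.hasDerivAt_slice_right (h : ContDiff ℝ 1 Ψ) (v1 v2 : ℝ × ℝ) (ξ : ℝ) (z : ℝ × ℝ) :
    HasDerivAt (fun t : ℝ => Ψ (ξ, z.1 • v1 + t • v2))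
      (dirDeriv (0, v2) Ψ (ξ, z.1 • v1 + z.2 • v2)) z.2 := by
  refine h.hasDerivAt_comp_dirDeriv (c := fun s => (ξ, z.1 • v1 + s • v2)) ?_
  refine (hasDerivAt_const _ _).prodMk ?_
  simpa using ((hasDerivAt_id z.2).smul_const v2).const_add (z.1 • v1)

lemma exists_smul_add_smul (hdet : |v1.1 * v2.2 - v1.2 * v2.1| = 1) (e : ℝ × ℝ) :
    ∃ a b : ℝ, e = a • v1 + b • v2 := by
  have hD : v1.1 * v2.2 - v1.2 * v2.1 ≠ 0 := by
    intro h; rw [h] at hdet; simp at hdet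
  set D := v1.1 * v2.2 - v1.2 * v2.1 with hDdef
  refine ⟨(e.1 * v2.2 - e.2 * v2.1) / D, (v1.1 * e.2 - v1.2 * e.1) / D, ?_⟩
  ext
  · simp; field_simp; rw [hDdef]; ring
  · simp; field_simp; rw [hDdef]; ring

/-- Derivatives of periodic functions average to zero. -/
lemma latticeAvg_dirDeriv_eq_zero (hdet : |v1.1 * v2.2 - v1.2 * v2.1| = 1)
    (h : ContDiff ℝ 1 Ψ) (hper : SlicePeriodic v1 v2 Ψ) (e : ℝ × ℝ) :
    latticeAvg v1 v2 (dirDeriv (0, e) Ψ) ξ = 0 := by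
  have hc := fun e => h.continuous_dirDeriv e
  have z1 : latticeAvg v1 v2 (dirDeriv (0, v1) Ψ) ξ = 0 := by
    rw [latticeAvg, integral_prod_symm _ ((hc _).integrable_slice v1 v2 ξ)]
    refine integral_eq_zero_of_ae (Filter.Eventually.of_forall fun t => ?_)
    dsimp only [Pi.zero_apply]
    rw [← intervalIntegral.integral_of_le zero_le_one,
      intervalIntegral.integral_eq_sub_of_hasDerivAt
        (f := fun s => Ψ (ξ, s • v1 + t • v2)) (fun s _ => h.hasDerivAt_slice_left v1 v2 ξ (s, t))
        (Continuous.intervalIntegrable (by have := hc (0, v1); fun_prop) _ _), sub_eq_zero]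
    have := hper.1 (ξ, (0:ℝ) • v1 + t • v2)
    rw [← this]
    congr 1
    simp [add_comm]
  have z2 : latticeAvg v1 v2 (dirDeriv (0, v2) Ψ) ξ = 0 := by
    rw [latticeAvg, integral_prod _ ((hc _).integrable_slice v1 v2 ξ)]
    refine integral_eq_zero_of_ae (Filter.Eventually.of_forall fun s => ?_)
    dsimp only [Pi.zero_apply]
    rw [← intervalIntegral.integral_of_le zero_le_one,
      intervalIntegral.integral_eq_sub_of_hasDerivAt
        (f := fun t => Ψ (ξ, s • v1 + t • v2)) (fun t _ => h.hasDerivAt_slice_right v1 v2 ξ (s, t))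
        (Continuous.intervalIntegrable (by have := hc (0, v2); fun_prop) _ _), sub_eq_zero]
    have := hper.2 (ξ, s • v1 + (0:ℝ) • v2)
    rw [← this]
    congr 1
    simp
  obtain ⟨a, b, rfl⟩ := exists_smul_add_smul hdet e
  have : dirDeriv (0, a • v1 + b • v2) Ψ
      = fun p => a * dirDeriv (0, v1) Ψ p + b * dirDeriv (0, v2) Ψ p := by
    funext p
    rw [← dirDeriv_smul_add_smul]
    simp
  rw [this, latticeAvg_add ((hc _).const_mul _) ((hc _).const_mul _), latticeAvg_const_mul,
    latticeAvg_const_mul, z1, z2]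
  simp

lemma latticeAvg_sq_le (h : ContDiff ℝ 1 Ψ) (hmean : latticeAvg v1 v2 Ψ ξ = 0) :
    latticeAvg v1 v2 (fun p => Ψ p ^ 2) ξ ≤
      2 * latticeAvg v1 v2 (fun p => dirDeriv (0, v1) Ψ p ^ 2 + dirDeriv (0, v2) Ψ p ^ 2) ξ := by
  have := h.continuous
  have := h.continuous_dirDeriv (0, v1)
  have := h.continuous_dirDeriv (0, v2)
  exact poincare_unitSquare (h.hasDerivAt_slice_left v1 v2 ξ) (h.hasDerivAt_slice_right v1 v2 ξ)
    (by fun_prop) (by fun_prop) (by fun_prop) hmean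

lemma latticeAvg_sq_le_sq (h : ContDiff ℝ 1 Ψ) (v1 v2 : ℝ × ℝ) (ξ : ℝ) :
    latticeAvg v1 v2 (fun p => Ψ p ^ 2) ξ ≤
      latticeAvg v1 v2
        (fun p => |Ψ p| + |dirDeriv (0, v1) Ψ p| + |dirDeriv (0, v2) Ψ p|) ξ ^ 2 := by
  have := h.continuous
  have := h.continuous_dirDeriv (0, v1)
  have := h.continuous_dirDeriv (0, v2)
  exact sobolev_unitSquare (h.hasDerivAt_slice_left v1 v2 ξ) (h.hasDerivAt_slice_right v1 v2 ξ)
    (by fun_prop) (by fun_prop) (by fun_prop)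

/-- The point of the closed unit square representing a point of the plane modulo the lattice. -/
lemma SlicePeriodic.exists_eq (hdet : |v1.1 * v2.2 - v1.2 * v2.1| = 1)
    (hper : SlicePeriodic v1 v2 Ψ) (ξ : ℝ) (q : ℝ × ℝ) :
    ∃ z ∈ Set.Icc (0:ℝ) 1 ×ˢ Set.Icc (0:ℝ) 1, Ψ (ξ, q) = Ψ (ξ, z.1 • v1 + z.2 • v2) := by
  obtain ⟨a, b, rfl⟩ := exists_smul_add_smul hdet q
  refine ⟨(Int.fract a, Int.fract b), ⟨⟨Int.fract_nonneg a, (Int.fract_lt_one a).le⟩,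
    ⟨Int.fract_nonneg b, (Int.fract_lt_one b).le⟩⟩, ?_⟩
  rw [← hper.1.sub_zsmul_eq ⌊a⌋, ← hper.2.sub_zsmul_eq ⌊b⌋]
  congr 1
  ext
  · simp
  · simp [← Int.self_sub_floor]; ring
  · simp [← Int.self_sub_floor]; ring

end latticeAvg

section Toda

variable {v1 v2 : ℝ × ℝ} {V : ℝ × ℝ × ℝ → ℝ}

/-- The divergence structure of the Toda equation: the second derivative of the slice average of
`Φ (e^V)`. -/
lemma latticeAvg_dirDeriv_dirDeriv_comp_exp (hdet : |v1.1 * v2.2 - v1.2 * v2.1| = 1)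
    (hV : ContDiff ℝ 2 V) (hper : SlicePeriodic v1 v2 V)
    (heq : ∀ ξ, 0 ≤ ξ → ∀ q, dirDeriv (1, 0) (dirDeriv (1, 0) fun p => exp (V p)) (ξ, q)
      + dirDeriv (0, 1, 0) (dirDeriv (0, 1, 0) V) (ξ, q)
      + dirDeriv (0, 0, 1) (dirDeriv (0, 0, 1) V) (ξ, q) = 0)
    {Φ Φ1 Φ2 : ℝ → ℝ} (hΦ : ∀ x, HasDerivAt Φ (Φ1 x) x) (hΦ1 : ∀ x, HasDerivAt Φ1 (Φ2 x) x)
    (hc1 : ContDiff ℝ 1 Φ1) (hc2 : Continuous Φ2) {ξ : ℝ} (hξ : 0 ≤ ξ) :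
    latticeAvg v1 v2 (dirDeriv (1, 0) (dirDeriv (1, 0) fun p => Φ (exp (V p)))) ξ =
      latticeAvg v1 v2 (fun p => Φ2 (exp (V p)) * (dirDeriv (1, 0) (fun p => exp (V p)) p ^ 2
        + exp (V p) * (dirDeriv (0, 1, 0) V p ^ 2 + dirDeriv (0, 0, 1) V p ^ 2))) ξ := by
  set H : ℝ × ℝ × ℝ → ℝ := fun p => exp (V p) with hH
  have hHc : ContDiff ℝ 2 H := hV.exp
  have hH1 : ContDiff ℝ 1 H := hHc.of_le (by norm_num)
  have hHd : Differentiable ℝ H := hH1.differentiable (by norm_num)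
  have hDH := fun e => hHc.dirDeriv_two e
  have hDV := fun e => hV.dirDeriv_two e
  have hΦH : ContDiff ℝ 1 fun p => Φ1 (H p) := hc1.comp hH1
  have hf : ∀ e, ContDiff ℝ 1 fun p => Φ1 (H p) * dirDeriv e V p := fun e => hΦH.mul (hDV e)
  have hfper : ∀ e, SlicePeriodic v1 v2 fun p => Φ1 (H p) * dirDeriv e V p := fun e => by
    constructor <;> intro p
    · simp only [hH]; rw [hper.1 p, (hper.dirDeriv e).1 p]
    · simp only [hH]; rw [hper.2 p, (hper.dirDeriv e).2 p]
  have hD : ∀ e p, dirDeriv e H p = H p * dirDeriv e V p := fun e p =>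
    (Real.hasDerivAt_exp (V p)).dirDeriv_comp (hV.differentiable (by norm_num) p) e
  have h1 : dirDeriv (1, 0) (fun p => Φ (H p)) = fun p => Φ1 (H p) * dirDeriv (1, 0) H p :=
    funext fun p => (hΦ (H p)).dirDeriv_comp (hHd p) _
  have h2 : ∀ (e : ℝ × ℝ × ℝ) (Θ : ℝ × ℝ × ℝ → ℝ) (p : ℝ × ℝ × ℝ), ContDiff ℝ 1 Θ →
      dirDeriv e (fun p => Φ1 (H p) * Θ p) p
        = Φ1 (H p) * dirDeriv e Θ p + Φ2 (H p) * dirDeriv e H p * Θ p := fun e Θ p hΘ => by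
    rw [dirDeriv_mul (hΦH.differentiable (by norm_num) p) (hΘ.differentiable (by norm_num) p),
      (hΦ1 (H p)).dirDeriv_comp (hHd p)]
  have hx := latticeAvg_dirDeriv_eq_zero (ξ := ξ) hdet (hf (0, 1, 0)) (hfper _) (1, 0)
  have hy := latticeAvg_dirDeriv_eq_zero (ξ := ξ) hdet (hf (0, 0, 1)) (hfper _) (0, 1)
  have cH := hH1.continuous
  have cDH := (hDH (1, 0)).continuous
  have cDx := (hDV (0, 1, 0)).continuous
  have cDy := (hDV (0, 0, 1)).continuous
  have cfx := (hf (0, 1, 0)).continuous_dirDeriv (0, 1, 0)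
  have cfy := (hf (0, 0, 1)).continuous_dirDeriv (0, 0, 1)
  have hpt : latticeAvg v1 v2 (dirDeriv (1, 0) (dirDeriv (1, 0) fun p => Φ (H p))) ξ =
      latticeAvg v1 v2 (fun p => Φ2 (H p) * (dirDeriv (1, 0) H p ^ 2
        + H p * (dirDeriv (0, 1, 0) V p ^ 2 + dirDeriv (0, 0, 1) V p ^ 2))
        - dirDeriv (0, 1, 0) (fun p => Φ1 (H p) * dirDeriv (0, 1, 0) V p) p
        - dirDeriv (0, 0, 1) (fun p => Φ1 (H p) * dirDeriv (0, 0, 1) V p) p) ξ := by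
    refine integral_congr_ae (Filter.Eventually.of_forall fun z => ?_)
    have he := heq ξ hξ (z.1 • v1 + z.2 • v2)
    dsimp only
    rw [h1, h2 _ _ _ (hDH _), h2 _ _ _ (hDV _), h2 _ _ _ (hDV _), hD (0, 1, 0), hD (0, 0, 1)]
    linear_combination Φ1 (H (ξ, z.1 • v1 + z.2 • v2)) * he
  rw [hpt, latticeAvg_sub (by fun_prop) cfy, latticeAvg_sub (by fun_prop) cfx, hx, hy,
    sub_zero, sub_zero]

variable {M : ℝ}

/-- The slice averages of `e^V` do not depend on the slice. -/
lemma latticeAvg_exp_eq (hdet : |v1.1 * v2.2 - v1.2 * v2.1| = 1)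
    (hV : ContDiff ℝ 2 V) (hper : SlicePeriodic v1 v2 V)
    (heq : ∀ ξ, 0 ≤ ξ → ∀ q, dirDeriv (1, 0) (dirDeriv (1, 0) fun p => exp (V p)) (ξ, q)
      + dirDeriv (0, 1, 0) (dirDeriv (0, 1, 0) V) (ξ, q)
      + dirDeriv (0, 0, 1) (dirDeriv (0, 0, 1) V) (ξ, q) = 0)
    (hM : ∀ ξ, 0 ≤ ξ → ∀ q, |V (ξ, q)| ≤ M) {ξ : ℝ} (hξ : 0 ≤ ξ) :
    latticeAvg v1 v2 (fun p => exp (V p)) ξ = latticeAvg v1 v2 (fun p => exp (V p)) 0 := by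
  have hHc : ContDiff ℝ 2 fun p => exp (V p) := hV.exp
  have cH := hHc.continuous
  have d1 := hasDerivAt_latticeAvg (hHc.of_le (by norm_num)) v1 v2
  have d2 := hasDerivAt_latticeAvg (hHc.dirDeriv_two (1, 0)) v1 v2
  have h0 : ∀ x, 0 ≤ x → latticeAvg v1 v2
      (dirDeriv (1, 0) (dirDeriv (1, 0) fun p => exp (V p))) x = 0 := fun x hx => by
    have := latticeAvg_dirDeriv_dirDeriv_comp_exp hdet hV hper heq (Φ := fun x => x)
      (Φ1 := fun _ => 1) (Φ2 := fun _ => 0) hasDerivAt_id (fun x => hasDerivAt_const x _)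
      contDiff_const continuous_const hx
    simpa [latticeAvg_const] using this
  have hle : ∀ x, 0 ≤ x → latticeAvg v1 v2 (fun p => exp (V p)) x ≤ exp M := fun x hx =>
    (latticeAvg_mono cH continuous_const fun q =>
      exp_le_exp.2 (abs_le.1 (hM x hx q)).2).trans_eq (latticeAvg_const _)
  have hge : ∀ x, 0 ≤ x → -latticeAvg v1 v2 (fun p => exp (V p)) x ≤ 0 := fun x hx =>
    neg_nonpos.2 (latticeAvg_nonneg fun q => (exp_pos _).le)
  have a1 := antitoneOn_of_bddAbove d1 d2 (fun x hx => (h0 x hx).ge) hle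
  have a2 := antitoneOn_of_bddAbove (fun x => (d1 x).fun_neg) (fun x => (d2 x).fun_neg)
    (fun x hx => by rw [h0 x hx, neg_zero]) hge
  exact le_antisymm (a1 Set.self_mem_Ici hξ hξ) (neg_le_neg_iff.1 (a2 Set.self_mem_Ici hξ hξ))

/-- The gradient along the lattice is controlled by the energy density. -/
lemma dirDeriv_sq_add_sq_le (hV : ContDiff ℝ 2 V) {p : ℝ × ℝ × ℝ} (hM : V p ≤ M)
    (v1 v2 : ℝ × ℝ) (k : ℝ) :
    dirDeriv (0, v1) (fun p => exp (V p) - k) p ^ 2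
        + dirDeriv (0, v2) (fun p => exp (V p) - k) p ^ 2 ≤
      ((v1.1 ^ 2 + v1.2 ^ 2 + v2.1 ^ 2 + v2.2 ^ 2 + 1) * exp M) *
        (exp (V p) * (dirDeriv (0, 1, 0) V p ^ 2 + dirDeriv (0, 0, 1) V p ^ 2)) := by
  have hD : ∀ u : ℝ × ℝ, dirDeriv (0, u) (fun p => exp (V p) - k) p
      = exp (V p) * (u.1 * dirDeriv (0, 1, 0) V p + u.2 * dirDeriv (0, 0, 1) V p) := fun u => by
    rw [((Real.hasDerivAt_exp (V p)).sub_const k).dirDeriv_comp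
      (f := fun x => exp x - k) (hV.differentiable (by norm_num) p),
      ← dirDeriv_smul_add_smul]
    simp
  rw [hD, hD]
  set a := dirDeriv (0, 1, 0) V p
  set b := dirDeriv (0, 0, 1) V p
  have hcs : ∀ u : ℝ × ℝ, (u.1 * a + u.2 * b) ^ 2 ≤ (u.1 ^ 2 + u.2 ^ 2) * (a ^ 2 + b ^ 2) :=
    fun u => by nlinarith [sq_nonneg (u.1 * b - u.2 * a)]
  have h1 : exp (V p) * exp (V p) ≤ exp M * exp (V p) :=
    mul_le_mul_of_nonneg_right (exp_le_exp.2 hM) (exp_pos _).le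
  calc _ = exp (V p) * exp (V p) * ((v1.1 * a + v1.2 * b) ^ 2 + (v2.1 * a + v2.2 * b) ^ 2) := by
        ring
    _ ≤ exp M * exp (V p) *
        ((v1.1 ^ 2 + v1.2 ^ 2 + v2.1 ^ 2 + v2.2 ^ 2 + 1) * (a ^ 2 + b ^ 2)) := by
        refine mul_le_mul h1 ?_ (by positivity) (by positivity)
        nlinarith [hcs v1, hcs v2, sq_nonneg a, sq_nonneg b]
    _ = _ := by ring

lemma latticeAvg_pow_deriv2_ge (hdet : |v1.1 * v2.2 - v1.2 * v2.1| = 1)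
    (hV : ContDiff ℝ 2 V) (hper : SlicePeriodic v1 v2 V)
    (heq : ∀ ξ, 0 ≤ ξ → ∀ q, dirDeriv (1, 0) (dirDeriv (1, 0) fun p => exp (V p)) (ξ, q)
      + dirDeriv (0, 1, 0) (dirDeriv (0, 1, 0) V) (ξ, q)
      + dirDeriv (0, 0, 1) (dirDeriv (0, 0, 1) V) (ξ, q) = 0)
    (hM : ∀ ξ, 0 ≤ ξ → ∀ q, |V (ξ, q)| ≤ M) (k : ℝ) (m : ℕ) {ξ : ℝ} (hξ : 0 ≤ ξ) :
    latticeAvg v1 v2 (fun p => (2 * m + 2) * (2 * m + 1) * (exp (V p) - k) ^ (2 * m) *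
        (dirDeriv (0, v1) (fun p => exp (V p) - k) p ^ 2
        + dirDeriv (0, v2) (fun p => exp (V p) - k) p ^ 2)) ξ ≤
      ((v1.1 ^ 2 + v1.2 ^ 2 + v2.1 ^ 2 + v2.2 ^ 2 + 1) * exp M) *
      latticeAvg v1 v2 (dirDeriv (1, 0)
        (dirDeriv (1, 0) fun p => (exp (V p) - k) ^ (2 * m + 2))) ξ := by
  have hΦ : ∀ x, HasDerivAt (fun x : ℝ => (x - k) ^ (2 * m + 2))
      ((2 * m + 2) * (x - k) ^ (2 * m + 1)) x := fun x => by
    refine (((hasDerivAt_id x).sub_const k).fun_pow (2 * m + 2)).congr_deriv ?_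
    simp
  have hΦ1 : ∀ x, HasDerivAt (fun x : ℝ => (2 * m + 2) * (x - k) ^ (2 * m + 1))
      ((2 * m + 2) * (2 * m + 1) * (x - k) ^ (2 * m)) x := fun x => by
    refine ((((hasDerivAt_id x).sub_const k).fun_pow (2 * m + 1)).const_mul
      (2 * (m:ℝ) + 2)).congr_deriv ?_
    simp; ring
  rw [latticeAvg_dirDeriv_dirDeriv_comp_exp hdet hV hper heq
    (Φ := fun x : ℝ => (x - k) ^ (2 * m + 2)) hΦ hΦ1 (by fun_prop) (by fun_prop) hξ,
    ← latticeAvg_const_mul]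
  have hW : ContDiff ℝ 1 fun p => exp (V p) - k :=
    ((hV.exp).sub contDiff_const).of_le (by norm_num)
  have c1 := hW.continuous_dirDeriv (0, v1)
  have c2 := hW.continuous_dirDeriv (0, v2)
  have c3 := (hV.dirDeriv_two (0, 1, 0)).continuous
  have c4 := (hV.dirDeriv_two (0, 0, 1)).continuous
  have c5 := ((hV.exp).dirDeriv_two (1, 0)).continuous
  have c6 := hV.continuous
  refine latticeAvg_mono (by fun_prop) (by fun_prop) fun q => ?_
  have hg := dirDeriv_sq_add_sq_le hV (abs_le.1 (hM ξ hξ q)).2 v1 v2 k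
  set K := (v1.1 ^ 2 + v1.2 ^ 2 + v2.1 ^ 2 + v2.2 ^ 2 + 1) * exp M
  have hK : 0 ≤ K := by positivity
  have hw : 0 ≤ (exp (V (ξ, q)) - k) ^ (2 * m) := by rw [pow_mul]; positivity
  rw [mul_left_comm]
  refine mul_le_mul_of_nonneg_left ?_ (by positivity)
  refine hg.trans (mul_le_mul_of_nonneg_left ?_ hK)
  exact le_add_of_nonneg_left (by positivity)

lemma latticeAvg_pow_deriv2_nonneg (hdet : |v1.1 * v2.2 - v1.2 * v2.1| = 1)
    (hV : ContDiff ℝ 2 V) (hper : SlicePeriodic v1 v2 V)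
    (heq : ∀ ξ, 0 ≤ ξ → ∀ q, dirDeriv (1, 0) (dirDeriv (1, 0) fun p => exp (V p)) (ξ, q)
      + dirDeriv (0, 1, 0) (dirDeriv (0, 1, 0) V) (ξ, q)
      + dirDeriv (0, 0, 1) (dirDeriv (0, 0, 1) V) (ξ, q) = 0)
    (hM : ∀ ξ, 0 ≤ ξ → ∀ q, |V (ξ, q)| ≤ M) (k : ℝ) (m : ℕ) {ξ : ℝ} (hξ : 0 ≤ ξ) :
    0 ≤ latticeAvg v1 v2 (dirDeriv (1, 0)
        (dirDeriv (1, 0) fun p => (exp (V p) - k) ^ (2 * m + 2))) ξ := by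
  have h := latticeAvg_pow_deriv2_ge hdet hV hper heq hM k m hξ
  have hK : 0 < (v1.1 ^ 2 + v1.2 ^ 2 + v2.1 ^ 2 + v2.2 ^ 2 + 1) * exp M := by positivity
  refine (mul_nonneg_iff_of_pos_left hK).1 (le_trans ?_ h)
  refine latticeAvg_nonneg fun q => ?_
  have hw : 0 ≤ (exp (V (ξ, q)) - k) ^ (2 * m) := by rw [pow_mul]; positivity
  positivity

/-- The differential inequality between consecutive slice norms. -/
lemma latticeAvg_pow_double_le (hdet : |v1.1 * v2.2 - v1.2 * v2.1| = 1)
    (hV : ContDiff ℝ 2 V) (hper : SlicePeriodic v1 v2 V)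
    (heq : ∀ ξ, 0 ≤ ξ → ∀ q, dirDeriv (1, 0) (dirDeriv (1, 0) fun p => exp (V p)) (ξ, q)
      + dirDeriv (0, 1, 0) (dirDeriv (0, 1, 0) V) (ξ, q)
      + dirDeriv (0, 0, 1) (dirDeriv (0, 0, 1) V) (ξ, q) = 0)
    (hM : ∀ ξ, 0 ≤ ξ → ∀ q, |V (ξ, q)| ≤ M) (k : ℝ) (m : ℕ) {ξ : ℝ} (hξ : 0 ≤ ξ) :
    latticeAvg v1 v2 (fun p => (exp (V p) - k) ^ (2 * (2 * m + 2))) ξ ≤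
      (3 * latticeAvg v1 v2 (fun p => (exp (V p) - k) ^ (2 * m + 2)) ξ
      + ((v1.1 ^ 2 + v1.2 ^ 2 + v2.1 ^ 2 + v2.2 ^ 2 + 1) * exp M) *
      latticeAvg v1 v2 (dirDeriv (1, 0)
        (dirDeriv (1, 0) fun p => (exp (V p) - k) ^ (2 * m + 2))) ξ) ^ 2 := by
  set W : ℝ × ℝ × ℝ → ℝ := fun p => exp (V p) - k with hWdef
  have hW : ContDiff ℝ 1 W := ((hV.exp).sub contDiff_const).of_le (by norm_num)
  have hWn : ContDiff ℝ 1 fun p => W p ^ (2 * m + 2) := hW.pow _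
  have hD : ∀ e p, dirDeriv e (fun p => W p ^ (2 * m + 2)) p
      = (2 * m + 2) * W p ^ (2 * m + 1) * dirDeriv e W p := fun e p => by
    have := (hasDerivAt_pow (2 * m + 2) (W p)).dirDeriv_comp (hW.differentiable (by norm_num) p) e
    simpa using this
  have c0 := hW.continuous
  have c1 := hW.continuous_dirDeriv (0, v1)
  have c2 := hW.continuous_dirDeriv (0, v2)
  have d1 := hWn.continuous_dirDeriv (0, v1)
  have d2 := hWn.continuous_dirDeriv (0, v2)
  have h1 := latticeAvg_sq_le_sq hWn v1 v2 ξ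
  simp only [← pow_mul, mul_comm _ 2] at h1
  refine h1.trans (pow_le_pow_left₀ (latticeAvg_nonneg fun q => by positivity) ?_ 2)
  have h2 := latticeAvg_pow_deriv2_ge hdet hV hper heq hM k m hξ
  have h3 : latticeAvg v1 v2 (fun p => |W p ^ (2 * m + 2)|
      + |dirDeriv (0, v1) (fun p => W p ^ (2 * m + 2)) p|
      + |dirDeriv (0, v2) (fun p => W p ^ (2 * m + 2)) p|) ξ ≤
      latticeAvg v1 v2 (fun p => 3 * W p ^ (2 * m + 2) +
        (2 * m + 2) * (2 * m + 1) * W p ^ (2 * m) *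
        (dirDeriv (0, v1) W p ^ 2 + dirDeriv (0, v2) W p ^ 2)) ξ := by
    refine latticeAvg_mono (by fun_prop) (by fun_prop) fun q => ?_
    rw [hD, hD]
    set w := W (ξ, q)
    have hw : 0 ≤ w ^ (2 * m) := by rw [pow_mul]; positivity
    have key : ∀ g : ℝ, |(2 * m + 2) * w ^ (2 * m + 1) * g| ≤
        w ^ (2 * m + 2) + (2 * m + 2) * (2 * m + 1) * w ^ (2 * m) * g ^ 2 := by
      intro g
      have e1 : |(2 * m + 2) * w ^ (2 * m + 1) * g|
          = w ^ (2 * m) * (|w| * ((2 * m + 2) * |g|)) := by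
        rw [pow_succ, abs_mul, abs_mul, abs_mul, abs_of_nonneg hw,
          abs_of_nonneg (by positivity : (0:ℝ) ≤ 2 * m + 2)]
        ring
      have e2 : w ^ (2 * m + 2) + (2 * m + 2) * (2 * m + 1) * w ^ (2 * m) * g ^ 2
          = w ^ (2 * m) * (|w| ^ 2 + (2 * m + 2) * (2 * m + 1) * |g| ^ 2) := by
        rw [sq_abs, sq_abs]; ring
      rw [e1, e2]
      refine mul_le_mul_of_nonneg_left ?_ hw
      have hm : (0:ℝ) ≤ m := Nat.cast_nonneg m
      nlinarith [sq_nonneg (|w| - (m + 1) * |g|), mul_nonneg hm (sq_nonneg |g|),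
        mul_nonneg (mul_nonneg hm hm) (sq_nonneg |g|), sq_nonneg |g|]
    have e0 : |w ^ (2 * m + 2)| = w ^ (2 * m + 2) :=
      abs_of_nonneg (by rw [pow_add]; positivity)
    rw [e0]
    linarith [key (dirDeriv (0, v1) W (ξ, q)), key (dirDeriv (0, v2) W (ξ, q))]
  refine h3.trans ?_
  rw [latticeAvg_add (by fun_prop) (by fun_prop), latticeAvg_const_mul]
  linarith

/-- The Moser iteration. -/
lemma le_pow_of_iterate {G : ℕ → ℝ → ℝ} {A a : ℝ} (hA : 1 ≤ A) (ha : 0 ≤ a)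
    (h0 : ∀ k x, 0 ≤ G k x) (hanti : ∀ k, AntitoneOn (G k) (Set.Ici 0))
    (hstep : ∀ k x l, 0 ≤ x → 0 < l → l ≤ 1 → G (k + 1) (x + l) ≤ (A / l ^ 2) ^ 2 * G k x ^ 2)
    (k : ℕ) : G k (a + 2) ≤ (16 * A ^ 2 * G 0 a) ^ (2 ^ k) := by
  set b : ℕ → ℝ := fun k => a + 2 - 2 * (1 / 2) ^ k with hb
  have hp : ∀ k : ℕ, (1 / 2 : ℝ) ^ k ≤ 1 := fun k => pow_le_one₀ (by norm_num) (by norm_num)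
  have hb0 : ∀ k, 0 ≤ b k := fun k => by simp only [hb]; linarith [hp k]
  have key : ∀ k, A ^ 2 * 16 ^ (k + 1) * G k (b k) ≤ (16 * A ^ 2 * G 0 a) ^ (2 ^ k) := by
    intro k
    induction k with
    | zero => simp [hb]; linarith
    | succ k ih =>
      have hs := hstep k (b k) ((1 / 2) ^ k) (hb0 k) (by positivity) (hp k)
      have hbk : b k + (1 / 2) ^ k = b (k + 1) := by simp only [hb]; ring
      have h16 : (((1 / 2 : ℝ) ^ k) ^ 2) ^ 2 = 1 / 16 ^ k := by
        rw [← pow_mul, ← pow_mul, mul_comm, pow_mul, pow_mul, ← one_div_pow]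
        norm_num
      rw [hbk, div_pow, h16, div_div_eq_mul_div, div_one] at hs
      have hx : 0 ≤ A ^ 2 * 16 ^ (k + 1) * G k (b k) := by
        have := h0 k (b k); positivity
      calc A ^ 2 * 16 ^ (k + 1 + 1) * G (k + 1) (b (k + 1))
          ≤ A ^ 2 * 16 ^ (k + 1 + 1) * (A ^ 2 * 16 ^ k * G k (b k) ^ 2) := by gcongr
        _ = (A ^ 2 * 16 ^ (k + 1) * G k (b k)) ^ 2 := by ring
        _ ≤ ((16 * A ^ 2 * G 0 a) ^ (2 ^ k)) ^ 2 := by gcongr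
        _ = _ := by rw [← pow_mul, pow_succ 2 k]
  refine le_trans ?_ (key k)
  have hle : G k (a + 2) ≤ G k (b k) := hanti k (hb0 k) (by simp; linarith)
    (by simp [hb])
  have h1 : (1:ℝ) ≤ A ^ 2 * 16 ^ (k + 1) :=
    one_le_mul_of_one_le_of_one_le (one_le_pow₀ hA) (one_le_pow₀ (by norm_num))
  nlinarith [h0 k (b k)]

/-- Exponential convergence of `e^V` to its mean. -/
lemma exists_abs_exp_sub_le (hdet : |v1.1 * v2.2 - v1.2 * v2.1| = 1)
    (hV : ContDiff ℝ 2 V) (hper : SlicePeriodic v1 v2 V)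
    (heq : ∀ ξ, 0 ≤ ξ → ∀ q, dirDeriv (1, 0) (dirDeriv (1, 0) fun p => exp (V p)) (ξ, q)
      + dirDeriv (0, 1, 0) (dirDeriv (0, 1, 0) V) (ξ, q)
      + dirDeriv (0, 0, 1) (dirDeriv (0, 0, 1) V) (ξ, q) = 0)
    (hM : ∀ ξ, 0 ≤ ξ → ∀ q, |V (ξ, q)| ≤ M) :
    ∃ C > (0:ℝ), ∃ δ > (0:ℝ), ∀ ξ, 0 ≤ ξ → ∀ q,
      |exp (V (ξ, q)) - latticeAvg v1 v2 (fun p => exp (V p)) 0| ≤ C * exp (-δ * ξ) := by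
  set k := latticeAvg v1 v2 (fun p => exp (V p)) 0 with hk
  set K := (v1.1 ^ 2 + v1.2 ^ 2 + v2.1 ^ 2 + v2.2 ^ 2 + 1) * exp M with hKdef
  have hK : 0 < K := by positivity
  set W : ℝ × ℝ × ℝ → ℝ := fun p => exp (V p) - k with hWdef
  have hW2 : ContDiff ℝ 2 W := (hV.exp).sub contDiff_const
  have hW : ContDiff ℝ 1 W := hW2.of_le (by norm_num)
  have cV := hV.continuous
  have cW := hW.continuous
  have hk0 : 0 ≤ k := latticeAvg_nonneg fun q => (exp_pos _).le
  have hkM : k ≤ exp M := (latticeAvg_mono (by fun_prop) continuous_const fun q =>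
      exp_le_exp.2 (abs_le.1 (hM 0 le_rfl q)).2).trans_eq (latticeAvg_const _)
  have hWb : ∀ ξ, 0 ≤ ξ → ∀ q, |W (ξ, q)| ≤ exp M := fun ξ hξ q => by
    have h1 := exp_le_exp.2 (abs_le.1 (hM ξ hξ q)).2
    have h2 := exp_pos (V (ξ, q))
    rw [abs_le]
    constructor <;> simp only [hWdef] <;> linarith
  have hWper : SlicePeriodic v1 v2 W := by
    constructor <;> intro p
    · simp only [hWdef]; rw [hper.1 p]
    · simp only [hWdef]; rw [hper.2 p]
  have hpow : ∀ m : ℕ, ContDiff ℝ 2 fun p => W p ^ (2 * m + 2) := fun m => hW2.pow _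
  have d1 := fun m : ℕ => hasDerivAt_latticeAvg ((hpow m).of_le one_le_two) v1 v2
  have d2 := fun m : ℕ => hasDerivAt_latticeAvg ((hpow m).dirDeriv_two (1, 0)) v1 v2
  have h2 := fun (m : ℕ) (x : ℝ) (hx : 0 ≤ x) =>
    latticeAvg_pow_deriv2_nonneg hdet hV hper heq hM k m hx
  have hB : ∀ (m : ℕ) (x : ℝ), 0 ≤ x →
      latticeAvg v1 v2 (fun p => W p ^ (2 * m + 2)) x ≤ exp M ^ (2 * m + 2) := fun m x hx =>
    (latticeAvg_mono (by fun_prop) continuous_const fun q => by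
      refine (le_abs_self _).trans ?_
      rw [abs_pow]
      exact pow_le_pow_left₀ (abs_nonneg _) (hWb x hx q) _).trans_eq (latticeAvg_const _)
  have hnn : ∀ (m : ℕ) (x : ℝ), 0 ≤ latticeAvg v1 v2 (fun p => W p ^ (2 * m + 2)) x :=
    fun m x => latticeAvg_nonneg fun q =>
      Even.pow_nonneg (by rw [← mul_add_one]; exact even_two_mul _) _
  have hanti := fun m : ℕ => antitoneOn_of_bddAbove (d1 m) (d2 m) (h2 m) (hB m)
  -- decay of the slice variance
  set δ := √(1 / K) with hδdef
  have hδ : 0 < δ := Real.sqrt_pos.2 (by positivity)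
  have hδ2 : δ ^ 2 = 1 / K := Real.sq_sqrt (by positivity)
  set F : ℝ → ℝ := latticeAvg v1 v2 fun p => W p ^ 2 with hF
  have hdecay : ∀ x, 0 ≤ x → F x ≤ F 0 * exp (-δ * x) := by
    refine fun x hx => le_mul_exp_of_sq_mul_le (d1 0) (d2 0) hδ (fun x _ => hnn 0 x) ?_
      (hB 0) hx
    intro x hx
    have hmean : latticeAvg v1 v2 W x = 0 := by
      rw [hWdef, latticeAvg_sub (by fun_prop) continuous_const, latticeAvg_const,
        latticeAvg_exp_eq hdet hV hper heq hM hx, sub_self]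
    have p1 := latticeAvg_sq_le hW hmean
    have p2 := latticeAvg_pow_deriv2_ge hdet hV hper heq hM k 0 hx
    rw [hδ2, one_div, inv_mul_le_iff₀ hK]
    simp only [Nat.cast_zero, mul_zero, zero_add, pow_zero, mul_one, latticeAvg_const_mul] at p2 ⊢
    exact p1.trans p2
  -- iteration
  set A := 3 + 2 * K with hA
  have hexp : ∀ j : ℕ, ∃ m : ℕ, 2 * 2 ^ j = 2 * m + 2 := fun j =>
    ⟨2 ^ j - 1, by have := Nat.one_le_two_pow (n := j); omega⟩
  have hsup : ∀ a, 0 ≤ a → ∀ q, W (a + 2, q) ^ 2 ≤ 16 * A ^ 2 * F a := by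
    intro a ha q
    obtain ⟨z, hz, hqz⟩ := hWper.exists_eq hdet (a + 2) q
    rw [hqz]
    refine sq_le_of_integral_pow_le (w := fun z => W (a + 2, z.1 • v1 + z.2 • v2))
      (by fun_prop) (mul_nonneg (by positivity) (hnn 0 a)) (fun j => ?_) hz
    have := le_pow_of_iterate (G := fun j => latticeAvg v1 v2 fun p => W p ^ (2 * 2 ^ j))
      (A := A) (by linarith) ha ?_ ?_ ?_ j
    · simp only [pow_zero, mul_one] at this
      exact this
    · intro j x
      obtain ⟨m, hm⟩ := hexp j
      simp only [hm]
      exact hnn m x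
    · intro j
      obtain ⟨m, hm⟩ := hexp j
      simp only [hm]
      exact hanti m
    · intro j x l hx hl hl1
      obtain ⟨m, hm⟩ := hexp j
      have hm' : 2 * 2 ^ (j + 1) = 2 * (2 * m + 2) := by rw [← hm]; ring
      have hm'' : 2 * (2 * m + 2) = 2 * (2 * m + 1) + 2 := by ring
      simp only [hm, hm']
      have hpos : ∀ y ∈ Set.Icc x (x + l), 0 ≤ y := fun y hy => hx.trans hy.1
      have hr : x + l ∈ Set.Icc x (x + l) := Set.right_mem_Icc.2 (by linarith)
      refine le_mul_sq_of_le_deriv2 (d1 m) (d2 m) hK hl hl1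
        (fun y hy => hanti m hx (hpos y hy) hy.1)
        (deriv_nonpos_of_bddAbove (d1 m) (d2 m) (h2 m) (hB m) (hpos _ hr)) (hnn m) ?_ ?_
        (fun y hy => h2 m y (hpos y hy))
        (fun y hy => latticeAvg_pow_double_le hdet hV hper heq hM k m (hpos y hy))
      · rw [hm'']; exact hnn _
      · rw [hm'']; exact fun y hy => hanti _ (hpos y hy) (hpos _ hr) hy.2
  refine ⟨√(16 * A ^ 2 * F 0) * exp δ + exp M * exp δ, by positivity, δ / 2, by positivity, ?_⟩
  intro ξ hξ q
  have hF0 : 0 ≤ F 0 := hnn 0 0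
  rw [add_mul]
  rcases le_total 2 ξ with h | h
  · refine le_add_of_le_of_nonneg ?_ (by positivity)
    have hs := hsup (ξ - 2) (by linarith) q
    rw [sub_add_cancel] at hs
    refine abs_le_of_sq_le_sq ?_ (by positivity)
    have he : (exp δ * exp (-(δ / 2) * ξ)) ^ 2 = exp (-δ * (ξ - 2)) := by
      rw [← exp_add, ← exp_nat_mul]
      congr 1
      push_cast
      ring
    rw [mul_assoc, mul_pow, Real.sq_sqrt (by positivity), he, mul_assoc]
    exact hs.trans (mul_le_mul_of_nonneg_left (hdecay _ (by linarith)) (by positivity))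
  · refine le_add_of_nonneg_of_le (by positivity) ((hWb ξ hξ q).trans ?_)
    rw [mul_assoc, ← exp_add]
    refine le_mul_of_one_le_right (exp_pos _).le (one_le_exp ?_)
    nlinarith

end Toda

lemma abs_log_sub_log_le {M a b : ℝ} (ha : exp (-M) ≤ a) (hb : exp (-M) ≤ b) :
    |log a - log b| ≤ exp M * |a - b| := by
  wlog hab : b ≤ a generalizing a b
  · rw [abs_sub_comm, abs_sub_comm a]
    exact this hb ha (le_of_not_ge hab)
  have hb0 : 0 < b := (exp_pos _).trans_le hb
  have ha0 : 0 < a := hb0.trans_le hab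
  rw [abs_of_nonneg (sub_nonneg.2 (log_le_log hb0 hab)), abs_of_nonneg (sub_nonneg.2 hab),
    ← log_div ha0.ne' hb0.ne']
  have h1 : 1 / b ≤ exp M := by
    rw [div_le_iff₀ hb0]
    calc (1:ℝ) = exp M * exp (-M) := by rw [← exp_add]; simp
      _ ≤ exp M * b := by gcongr
  calc log (a / b) ≤ a / b - 1 := log_le_sub_one_of_pos (by positivity)
    _ = 1 / b * (a - b) := by field_simp
    _ ≤ _ := mul_le_mul_of_nonneg_right h1 (sub_nonneg.2 hab)

lemma sliceAvg_eq_latticeAvg (v1 v2 : ℝ × ℝ) {Ψ : ℝ × ℝ × ℝ → ℝ} (h : Continuous Ψ) (ξ : ℝ) :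
    sliceAvg v1 v2 (fun x y => Ψ (ξ, x, y)) = latticeAvg v1 v2 Ψ ξ := by
  rw [latticeAvg, integral_prod _ (h.integrable_slice v1 v2 ξ)]
  simp only [sliceAvg, intervalIntegral.integral_of_le zero_le_one]
  rfl

lemma todaOp_eq {v : ℝ → ℝ → ℝ → ℝ}
    (hv : ContDiff ℝ 2 (fun p : ℝ × ℝ × ℝ => v p.1 p.2.1 p.2.2)) (ξ x y : ℝ) :
    todaOp v ξ x y =
      dirDeriv (1, 0) (dirDeriv (1, 0) fun p => exp (v p.1 p.2.1 p.2.2)) (ξ, x, y)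
      + dirDeriv (0, 1, 0) (dirDeriv (0, 1, 0) fun p => v p.1 p.2.1 p.2.2) (ξ, x, y)
      + dirDeriv (0, 0, 1) (dirDeriv (0, 0, 1) fun p => v p.1 p.2.1 p.2.2) (ξ, x, y) := by
  have key : ∀ {Ψ : ℝ × ℝ × ℝ → ℝ}, ContDiff ℝ 2 Ψ → ∀ {c : ℝ → ℝ × ℝ × ℝ} {e : ℝ × ℝ × ℝ},
      (∀ t, HasDerivAt c e t) → ∀ t, deriv (deriv fun s => Ψ (c s)) t
        = dirDeriv e (dirDeriv e Ψ) (c t) := by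
    intro Ψ hΨ c e hc t
    have h1 : (deriv fun s => Ψ (c s)) = fun s => dirDeriv e Ψ (c s) :=
      funext fun s => ((hΨ.of_le one_le_two).hasDerivAt_comp_dirDeriv (hc s)).deriv
    rw [h1]
    exact ((hΨ.dirDeriv_two e).hasDerivAt_comp_dirDeriv (hc t)).deriv
  have e1 := key hv.exp (c := fun s => (s, x, y)) (e := (1, 0))
    (fun t => (hasDerivAt_id t).prodMk (hasDerivAt_const t _)) ξ
  have e2 := key hv (c := fun s => (ξ, s, y)) (e := (0, 1, 0))
    (fun t => (hasDerivAt_const t _).prodMk ((hasDerivAt_id t).prodMk (hasDerivAt_const t _))) x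
  have e3 := key hv (c := fun s => (ξ, x, s)) (e := (0, 0, 1))
    (fun t => (hasDerivAt_const t _).prodMk ((hasDerivAt_const t _).prodMk (hasDerivAt_id t))) y
  rw [← e1, ← e2, ← e3]
  rfl

/-- Model asymptotics for BVP1: any bounded solution converges exponentially to the
constant `φ̄ = log ⨏ e^φ`. -/
theorem stmt5
    (v1 v2 : ℝ × ℝ) (hdet : |v1.1 * v2.2 - v1.2 * v2.1| = 1)
    (φ : ℝ → ℝ → ℝ)
    (hφreg : ContDiff ℝ (⊤ : ℕ∞) (fun p : ℝ × ℝ => φ p.1 p.2))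
    (hφper : LatticePeriodic v1 v2 φ)
    (v : ℝ → ℝ → ℝ → ℝ) (hv : IsSolBVP1 v1 v2 φ v) :
    ∃ C > (0:ℝ), ∃ δ > (0:ℝ), ∀ ξ ≥ (0:ℝ), ∀ x y : ℝ,
      |v ξ x y - Real.log (sliceAvg v1 v2 (fun x' y' => Real.exp (φ x' y')))| ≤
        C * Real.exp (-δ * ξ) := by
  obtain ⟨hreg, ⟨M, hM⟩, hper, hφ, htoda⟩ := hv
  set V : ℝ × ℝ × ℝ → ℝ := fun p => v p.1 p.2.1 p.2.2 with hVdef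
  have hM' : ∀ ξ, 0 ≤ ξ → ∀ q, |V (ξ, q)| ≤ M := fun ξ hξ q => hM ξ hξ q.1 q.2
  have hVper : SlicePeriodic v1 v2 V := by
    constructor <;> intro p
    · simpa [hVdef] using (hper p.1 p.2.1 p.2.2).1
    · simpa [hVdef] using (hper p.1 p.2.1 p.2.2).2
  obtain ⟨C, hC, δ, hδ, h⟩ := exists_abs_exp_sub_le hdet hreg hVper
    (fun ξ hξ q => (todaOp_eq hreg ξ q.1 q.2).symm.trans (htoda ξ hξ q.1 q.2)) hM'
  have cH : Continuous fun p => exp (V p) := hreg.exp.continuous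
  have havg : sliceAvg v1 v2 (fun x' y' => exp (φ x' y'))
      = latticeAvg v1 v2 (fun p => exp (V p)) 0 := by
    rw [← sliceAvg_eq_latticeAvg v1 v2 cH 0]
    simp only [hVdef, hφ]
  have hlow : ∀ ξ, 0 ≤ ξ → ∀ q, exp (-M) ≤ exp (V (ξ, q)) := fun ξ hξ q =>
    exp_le_exp.2 (abs_le.1 (hM' ξ hξ q)).1
  have hk : exp (-M) ≤ latticeAvg v1 v2 (fun p => exp (V p)) 0 :=
    (latticeAvg_const (v1 := v1) (v2 := v2) (ξ := 0) _).symm.trans_le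
      (latticeAvg_mono continuous_const cH (hlow 0 le_rfl))
  refine ⟨exp M * C, by positivity, δ, hδ, fun ξ hξ x y => ?_⟩
  have h1 := abs_log_sub_log_le (hlow ξ hξ (x, y)) hk
  rw [log_exp] at h1
  rw [havg, mul_assoc]
  exact h1.trans (mul_le_mul_of_nonneg_left (h ξ hξ (x, y)) (exp_pos _).le)
end
end

section
/- Let Λ ⊂ ℝ² be a lattice of covolume 1, let φ : ℝ² → ℝ be a smooth Λ-periodic function, and let v : [0,∞) × ℝ² → ℝ be a bounded, twice continuously differentiable, Λ-periodic solution of the Toda equation (e^v)_{ξξ} + v_{xx} + v_{yy} = 0 with v(0,·) = φ. Then W := 1 − (1/2)·ξ·v_ξ(ξ,x,y) > 0 for all ξ ≥ 0 and all (x,y) ∈ ℝ². -/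
open Real MeasureTheory

noncomputable section

section SecondDifferences

open Set Filter Topology

/-- The second derivative of `Φ` at `q` in the direction `e`. -/
def dirDeriv2 {E : Type*} [NormedAddCommGroup E] [NormedSpace ℝ E] (Φ : E → ℝ) (e q : E) : ℝ :=
  fderiv ℝ (fun r => fderiv ℝ Φ r e) q e

variable {E : Type*} [NormedAddCommGroup E] [NormedSpace ℝ E]

lemma contDiff_fderiv_apply {Φ : E → ℝ} (hΦ : ContDiff ℝ 2 Φ) (e : E) :
    ContDiff ℝ 1 (fun r => fderiv ℝ Φ r e) :=
  (hΦ.fderiv_right (m := 1) (by norm_num)).clm_apply contDiff_const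

lemma continuous_dirDeriv2 {Φ : E → ℝ} (hΦ : ContDiff ℝ 2 Φ) (e : E) :
    Continuous (dirDeriv2 Φ e) :=
  ((contDiff_fderiv_apply hΦ e).continuous_fderiv (by norm_num)).clm_apply continuous_const

lemma hasDerivAt_comp_line {Φ : E → ℝ} (hΦ : ContDiff ℝ 1 Φ) {c : ℝ → E} {e : E} {t : ℝ}
    (hc : HasDerivAt c e t) : HasDerivAt (fun t => Φ (c t)) (fderiv ℝ Φ (c t) e) t :=
  ((hΦ.differentiable (by norm_num) (c t)).hasFDerivAt).comp_hasDerivAt t hc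

lemma deriv_comp_line {Φ : E → ℝ} (hΦ : ContDiff ℝ 2 Φ) {c : ℝ → E} {e : E}
    (hc : ∀ t, HasDerivAt c e t) :
    deriv (fun t => Φ (c t)) = fun t => fderiv ℝ Φ (c t) e :=
  funext fun t => (hasDerivAt_comp_line (hΦ.of_le (by norm_num)) (hc t)).deriv

lemma hasDerivAt_deriv_comp_line {Φ : E → ℝ} (hΦ : ContDiff ℝ 2 Φ) {c : ℝ → E} {e : E}
    (hc : ∀ t, HasDerivAt c e t) (t : ℝ) :
    HasDerivAt (deriv fun t => Φ (c t)) (dirDeriv2 Φ e (c t)) t := by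
  rw [deriv_comp_line hΦ hc]
  exact hasDerivAt_comp_line (contDiff_fderiv_apply hΦ e) (hc t)

lemma deriv2_comp_line {Φ : E → ℝ} (hΦ : ContDiff ℝ 2 Φ) {c : ℝ → E} {e : E}
    (hc : ∀ t, HasDerivAt c e t) (t : ℝ) :
    deriv (deriv fun t => Φ (c t)) t = dirDeriv2 Φ e (c t) :=
  (hasDerivAt_deriv_comp_line hΦ hc t).deriv

/-- A lower bound for the second derivative bounds symmetric second differences from below. -/
lemma le_second_difference {Φ : E → ℝ} (hΦ : ContDiff ℝ 2 Φ) {p e : E} {m s : ℝ} (hs : 0 ≤ s)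
    (hm : ∀ t ∈ Icc (-s) s, m ≤ dirDeriv2 Φ e (p + t • e)) :
    m * s ^ 2 ≤ Φ (p + s • e) + Φ (p - s • e) - 2 * Φ p := by
  have hc : ∀ t : ℝ, HasDerivAt (fun t : ℝ => p + t • e) e t := fun t => by
    simpa using ((hasDerivAt_id t).smul_const e).const_add p
  have h1 : ∀ t : ℝ, HasDerivAt (fun t => Φ (p + t • e) - m / 2 * t ^ 2)
      (fderiv ℝ Φ (p + t • e) e - m * t) t := fun t => by
    refine ((hasDerivAt_comp_line (hΦ.of_le (by norm_num)) (hc t)).sub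
      ((hasDerivAt_pow 2 t).const_mul (m / 2))).congr_deriv ?_
    norm_num; ring
  have hd : deriv (fun t => Φ (p + t • e) - m / 2 * t ^ 2) =
      fun t => fderiv ℝ Φ (p + t • e) e - m * t := funext fun t => (h1 t).deriv
  have h2 : ∀ t : ℝ, HasDerivAt (deriv fun t => Φ (p + t • e) - m / 2 * t ^ 2)
      (dirDeriv2 Φ e (p + t • e) - m) t := fun t => by
    rw [hd]
    refine ((hasDerivAt_comp_line (contDiff_fderiv_apply hΦ e) (hc t)).sub
      ((hasDerivAt_id t).const_mul m)).congr_deriv ?_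
    simp [dirDeriv2]
  have hconv := convexOn_of_deriv2_nonneg' (convex_Icc (-s) s)
    (fun t _ => (h1 t).differentiableAt.differentiableWithinAt)
    (fun t _ => (h2 t).differentiableAt.differentiableWithinAt)
    (fun t ht => by
      simp only [Function.iterate_succ, Function.iterate_zero, Function.comp_apply, id_eq]
      rw [(h2 t).deriv]
      linarith [hm t ht])
  have := hconv.2 (left_mem_Icc.2 (by linarith)) (right_mem_Icc.2 (by linarith))
    (show (0 : ℝ) ≤ 1 / 2 by norm_num) (show (0 : ℝ) ≤ 1 / 2 by norm_num) (by norm_num)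
  simp only [smul_eq_mul, neg_smul, ← sub_eq_add_neg] at this
  rw [show (1 / 2 * -s + 1 / 2 * s : ℝ) = 0 by ring] at this
  simp only [zero_smul, add_zero] at this
  linarith

/-- Symmetric second differences are bounded below by the second derivative, up to an error that
is uniform on compact sets. -/
lemma eventually_le_second_difference {Φ : E → ℝ} (hΦ : ContDiff ℝ 2 Φ) {K : Set E}
    (hK : IsCompact K) (e : E) {δ : ℝ} (hδ : 0 < δ) :
    ∀ᶠ s in 𝓝[>] (0 : ℝ), ∀ p ∈ K,
      (dirDeriv2 Φ e p - δ) * s ^ 2 ≤ Φ (p + s • e) + Φ (p - s • e) - 2 * Φ p := by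
  have hU := hK.uniformContinuousAt_of_continuousAt (dirDeriv2 Φ e)
    (fun a _ => (continuous_dirDeriv2 hΦ e).continuousAt) (Metric.dist_mem_uniformity hδ)
  obtain ⟨ρ, hρ, hU⟩ := Metric.mem_uniformity_dist.1 hU
  have hlim : Tendsto (fun s : ℝ => s * ‖e‖) (𝓝[>] 0) (𝓝 0) := by
    have : Continuous fun s : ℝ => s * ‖e‖ := by fun_prop
    simpa using (this.tendsto 0).mono_left nhdsWithin_le_nhds
  filter_upwards [hlim.eventually (gt_mem_nhds hρ), self_mem_nhdsWithin] with s hs hs0 p hp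
  have hs0 : 0 < s := hs0
  refine le_second_difference hΦ hs0.le fun t ht => ?_
  have hdist : dist p (p + t • e) < ρ := by
    rw [dist_self_add_right, norm_smul]
    refine lt_of_le_of_lt ?_ hs
    gcongr
    exact abs_le.2 ht
  have h3 : dist (dirDeriv2 Φ e p) (dirDeriv2 Φ e (p + t • e)) < δ := hU hdist hp
  rw [Real.dist_eq, abs_lt] at h3
  linarith [h3.2]

end SecondDifferences

section CellIntegral

open Set Filter Topology

/-- The integral of a continuous `ℤ²`-periodic function over the unit square is invariant under
translations. -/
lemma integral_cell_translate {g : ℝ × ℝ → ℝ} (hg : Continuous g)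
    (h1 : ∀ s t, g (s + 1, t) = g (s, t)) (h2 : ∀ s t, g (s, t + 1) = g (s, t)) (a : ℝ × ℝ) :
    ∫ z in Icc (0 : ℝ × ℝ) 1, g (z + a) = ∫ z in Icc (0 : ℝ × ℝ) 1, g z := by
  have key : ∀ k : ℝ × ℝ → ℝ, Continuous k →
      ∫ z in Icc (0 : ℝ × ℝ) 1, k z = ∫ s in (0 : ℝ)..1, ∫ t in (0 : ℝ)..1, k (s, t) := by
    intro k hk
    have hQ : Icc (0 : ℝ × ℝ) 1 = Icc (0 : ℝ) 1 ×ˢ Icc (0 : ℝ) 1 := by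
      rw [Icc_prod_eq]; rfl
    have hi := hk.integrableOn_Icc (μ := volume) (a := (0 : ℝ × ℝ)) (b := 1)
    rw [hQ, Measure.volume_eq_prod] at *
    rw [setIntegral_prod k hi]
    simp only [intervalIntegral.integral_of_le zero_le_one, integral_Icc_eq_integral_Ioc]
  have shift : ∀ (k : ℝ → ℝ), (∀ t, k (t + 1) = k t) → ∀ b : ℝ,
      ∫ t in (0 : ℝ)..1, k (t + b) = ∫ t in (0 : ℝ)..1, k t := by
    intro k hk b
    have hp : Function.Periodic k 1 := hk
    rw [intervalIntegral.integral_comp_add_right]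
    simpa [add_comm] using hp.intervalIntegral_add_eq b 0
  rw [key _ (by fun_prop), key _ hg]
  have : ∀ s, ∫ t in (0 : ℝ)..1, g ((s, t) + a) = ∫ t in (0 : ℝ)..1, g (s + a.1, t) := fun s =>
    shift (fun t => g (s + a.1, t)) (fun t => h2 _ t) a.2
  simp only [this]
  exact shift (fun s => ∫ t in (0 : ℝ)..1, g (s, t)) (fun s => by simp only [h1]) a.1

/-- A nonnegative continuous `ℤ²`-periodic function with nonpositive integral vanishes. -/
lemma eq_zero_of_integral_cell_nonpos {g : ℝ × ℝ → ℝ} (hg : Continuous g)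
    (h1 : ∀ s t, g (s + 1, t) = g (s, t)) (h2 : ∀ s t, g (s, t + 1) = g (s, t))
    (h0 : ∀ z, 0 ≤ g z) (hI : ∫ z in Icc (0 : ℝ × ℝ) 1, g z ≤ 0) (z : ℝ × ℝ) : g z = 0 := by
  have hgz : Continuous fun w => g (w + z) := by fun_prop
  have hI' : ∫ w in Icc (0 : ℝ × ℝ) 1, g (w + z) = 0 := by
    rw [integral_cell_translate hg h1 h2 z]
    exact le_antisymm hI (integral_nonneg h0)
  rw [setIntegral_eq_zero_iff_of_nonneg_ae (ae_of_all _ fun w => h0 _) hgz.integrableOn_Icc] at hI'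
  have hQ : Icc (0 : ℝ × ℝ) 1 = Icc (0 : ℝ) 1 ×ˢ Icc (0 : ℝ) 1 := by
    rw [Icc_prod_eq]; rfl
  have := Measure.eqOn_of_ae_eq hI' hgz.continuousOn continuousOn_const (by
    rw [hQ, interior_prod_eq, closure_prod_eq, interior_Icc, closure_Ioo (by norm_num)])
  simpa using this (show (0 : ℝ × ℝ) ∈ Icc (0 : ℝ × ℝ) 1 from ⟨le_rfl, zero_le_one⟩)

end CellIntegral

section Comparison

open Set Filter Topology

/-- The point of the plane with coordinates `z` with respect to `v1, v2`. -/
def latticePoint (v1 v2 z : ℝ × ℝ) : ℝ × ℝ :=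
  (z.1 * v1.1 + z.2 * v2.1, z.1 * v1.2 + z.2 * v2.2)

lemma continuous_latticePoint (v1 v2 : ℝ × ℝ) : Continuous (latticePoint v1 v2) := by
  unfold latticePoint; fun_prop

lemma latticePoint_add (v1 v2 z w : ℝ × ℝ) :
    latticePoint v1 v2 (z + w) = latticePoint v1 v2 z + latticePoint v1 v2 w := by
  ext <;> simp [latticePoint] <;> ring

lemma latticePoint_surjective {v1 v2 : ℝ × ℝ} (hdet : v1.1 * v2.2 - v1.2 * v2.1 ≠ 0) :
    Function.Surjective (latticePoint v1 v2) := fun a =>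
  ⟨((a.1 * v2.2 - a.2 * v2.1) / (v1.1 * v2.2 - v1.2 * v2.1),
    (v1.1 * a.2 - v1.2 * a.1) / (v1.1 * v2.2 - v1.2 * v2.1)), by
    ext <;> simp only [latticePoint] <;> rw [div_mul_eq_mul_div, div_mul_eq_mul_div, ← add_div,
      div_eq_iff hdet] <;> ring⟩

variable {v1 v2 : ℝ × ℝ} {k : ℝ × ℝ → ℝ}

lemma comp_latticePoint_fst (h1 : ∀ q, k (q + v1) = k q) (s t : ℝ) :
    k (latticePoint v1 v2 (s + 1, t)) = k (latticePoint v1 v2 (s, t)) := by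
  rw [← h1 (latticePoint v1 v2 (s, t))]; congr 1; ext <;> simp [latticePoint] <;> ring

lemma comp_latticePoint_snd (h2 : ∀ q, k (q + v2) = k q) (s t : ℝ) :
    k (latticePoint v1 v2 (s, t + 1)) = k (latticePoint v1 v2 (s, t)) := by
  rw [← h2 (latticePoint v1 v2 (s, t))]; congr 1; ext <;> simp [latticePoint] <;> ring

lemma integral_lattice_translate (hdet : v1.1 * v2.2 - v1.2 * v2.1 ≠ 0) (hk : Continuous k)
    (h1 : ∀ q, k (q + v1) = k q) (h2 : ∀ q, k (q + v2) = k q) (a : ℝ × ℝ) :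
    ∫ z in Icc (0 : ℝ × ℝ) 1, k (latticePoint v1 v2 z + a) =
      ∫ z in Icc (0 : ℝ × ℝ) 1, k (latticePoint v1 v2 z) := by
  obtain ⟨b, rfl⟩ := latticePoint_surjective hdet a
  simp only [← latticePoint_add]
  exact integral_cell_translate (hk.comp (continuous_latticePoint v1 v2))
    (comp_latticePoint_fst h1) (comp_latticePoint_snd h2) b

lemma eq_zero_of_integral_lattice_nonpos (hdet : v1.1 * v2.2 - v1.2 * v2.1 ≠ 0)
    (hk : Continuous k) (h1 : ∀ q, k (q + v1) = k q) (h2 : ∀ q, k (q + v2) = k q)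
    (h0 : ∀ q, 0 ≤ k q) (hI : ∫ z in Icc (0 : ℝ × ℝ) 1, k (latticePoint v1 v2 z) ≤ 0)
    (q : ℝ × ℝ) : k q = 0 := by
  obtain ⟨b, rfl⟩ := latticePoint_surjective hdet q
  exact eq_zero_of_integral_cell_nonpos (hk.comp (continuous_latticePoint v1 v2))
    (comp_latticePoint_fst h1) (comp_latticePoint_snd h2) (fun _ => h0 _) hI b

lemma integral_cell_const (c : ℝ) : ∫ _ in Icc (0 : ℝ × ℝ) 1, c = c := by
  have : volume.real (Icc (0 : ℝ × ℝ) 1) = 1 := by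
    rw [Measure.real, Icc_prod_eq, Measure.volume_eq_prod, Measure.prod_prod]
    simp
  simp [this]

/-- If `f` and `h` are positive at the same points, a lower bound `-c` for the sum of second
differences of `f` (in `ξ`) and `h` (in `x` and `y`) passes to the positive part of `f`, averaged
over a fundamental cell: the spatial second differences of `h⁺` average to zero. -/
lemma second_difference_integral_posPart (hdet : v1.1 * v2.2 - v1.2 * v2.1 ≠ 0)
    {f h : ℝ × ℝ × ℝ → ℝ} (hf : Continuous f) (hh : Continuous h)
    (h1 : ∀ ξ q, h (ξ, q + v1) = h (ξ, q)) (h2 : ∀ ξ q, h (ξ, q + v2) = h (ξ, q))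
    (hpos : ∀ p, 0 < f p ↔ 0 < h p) {ξ s c : ℝ} (hc : 0 ≤ c)
    (hle : ∀ z ∈ Icc (0 : ℝ × ℝ) 1, ∀ q, q = latticePoint v1 v2 z →
      -c ≤ (f (ξ + s, q) + f (ξ - s, q) - 2 * f (ξ, q))
        + (h (ξ, q + (s, 0)) + h (ξ, q + (-s, 0)) - 2 * h (ξ, q))
        + (h (ξ, q + (0, s)) + h (ξ, q + (0, -s)) - 2 * h (ξ, q))) :
    -c ≤ (∫ z in Icc (0 : ℝ × ℝ) 1, max (f (ξ + s, latticePoint v1 v2 z)) 0)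
      + (∫ z in Icc (0 : ℝ × ℝ) 1, max (f (ξ - s, latticePoint v1 v2 z)) 0)
      - 2 * ∫ z in Icc (0 : ℝ × ℝ) 1, max (f (ξ, latticePoint v1 v2 z)) 0 := by
  have hL := continuous_latticePoint v1 v2
  have hk : Continuous fun q => max (h (ξ, q)) 0 := by fun_prop
  have htr := integral_lattice_translate hdet hk (fun q => by simp only [h1])
    (fun q => by simp only [h2])
  set F : ℝ → ℝ × ℝ → ℝ := fun x z => max (f (x, latticePoint v1 v2 z)) 0 with hF
  set H : ℝ × ℝ → ℝ × ℝ → ℝ := fun a z => max (h (ξ, latticePoint v1 v2 z + a)) 0 with hH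
  have cF : ∀ x, Continuous (F x) := fun x => by fun_prop
  have cH : ∀ a, Continuous (H a) := fun a => by fun_prop
  have key : ∫ z in Icc (0 : ℝ × ℝ) 1, (2 * F ξ z + 4 * H 0 z - c) ≤
      ∫ z in Icc (0 : ℝ × ℝ) 1, (F (ξ + s) z + F (ξ - s) z + (H (s, 0) z + H (-s, 0) z)
        + (H (0, s) z + H (0, -s) z)) := by
    refine setIntegral_mono_on (Continuous.integrableOn_Icc (by fun_prop))
      (Continuous.integrableOn_Icc (by fun_prop)) measurableSet_Icc fun z hz => ?_
    · have hz' := hle z hz _ rfl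
      simp only [hF, hH, add_zero]
      generalize latticePoint v1 v2 z = q at hz' ⊢
      by_cases hq : 0 < f (ξ, q)
      · have hq' := (hpos _).1 hq
        rw [max_eq_left hq.le, max_eq_left hq'.le]
        linarith [le_max_left (f (ξ + s, q)) 0, le_max_left (f (ξ - s, q)) 0,
          le_max_left (h (ξ, q + (s, 0))) 0, le_max_left (h (ξ, q + (-s, 0))) 0,
          le_max_left (h (ξ, q + (0, s))) 0, le_max_left (h (ξ, q + (0, -s))) 0]
      · have hq' : ¬ 0 < h (ξ, q) := fun h' => hq ((hpos _).2 h')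
        rw [max_eq_right (not_lt.1 hq), max_eq_right (not_lt.1 hq')]
        linarith [le_max_right (f (ξ + s, q)) 0, le_max_right (f (ξ - s, q)) 0,
          le_max_right (h (ξ, q + (s, 0))) 0, le_max_right (h (ξ, q + (-s, 0))) 0,
          le_max_right (h (ξ, q + (0, s))) 0, le_max_right (h (ξ, q + (0, -s))) 0]
  have e0 : ∀ a, ∫ z in Icc (0 : ℝ × ℝ) 1, H a z = ∫ z in Icc (0 : ℝ × ℝ) 1, H 0 z := fun a => by
    rw [htr a, htr 0]
  rw [integral_sub, integral_cell_const, integral_add, integral_const_mul, integral_const_mul,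
    integral_add, integral_add, integral_add, integral_add, integral_add, e0 (s, 0), e0 (-s, 0),
    e0 (0, s), e0 (0, -s)] at key
  · linarith
  all_goals exact Continuous.integrableOn_Icc (by fun_prop)

/-- A continuous function on `[0, T]` whose symmetric second differences at interior points are
bounded below by `-ε s²` for every `ε > 0` lies below the chord. -/
lemma le_chord_of_second_difference {F : ℝ → ℝ} (hF : Continuous F) {T M : ℝ} (hT : 0 < T)
    (h0 : F 0 ≤ 0) (hM : F T ≤ M)
    (hd : ∀ ξ ∈ Ioo 0 T, ∀ ε > 0, ∀ᶠ s in 𝓝[>] (0 : ℝ),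
      -(ε * s ^ 2) ≤ F (ξ + s) + F (ξ - s) - 2 * F ξ) {ξ : ℝ} (hξ : ξ ∈ Icc 0 T) :
    F ξ ≤ M * ξ / T := by
  by_contra! hlt
  set ε := (F ξ - M * ξ / T) / (T ^ 2 + 1) with hε
  have hε0 : 0 < ε := div_pos (by linarith) (by positivity)
  have hgap : ε * (T ^ 2 + 1) = F ξ - M * ξ / T := by rw [hε]; field_simp
  let G : ℝ → ℝ := fun x => F x - M * x / T + ε * (x ^ 2 - T * x)
  have hG : Continuous G := by fun_prop
  obtain ⟨x, hx, hmax⟩ := isCompact_Icc.exists_isMaxOn ⟨ξ, hξ⟩ hG.continuousOn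
  have hGx : 0 < G x := by
    refine lt_of_lt_of_le ?_ (hmax hξ)
    simp only [G]
    rw [← hgap]
    nlinarith [hξ.1, hξ.2, mul_nonneg hξ.1 hξ.1, mul_nonneg hξ.1 (sub_nonneg.2 hξ.2),
      mul_nonneg hT.le (sub_nonneg.2 hξ.2)]
  have hx0 : x ≠ 0 := by
    rintro rfl
    simp only [G] at hGx
    norm_num at hGx
    linarith
  have hxT : x ≠ T := by
    rintro rfl
    simp only [G] at hGx
    rw [mul_div_cancel_right₀ _ hT.ne'] at hGx
    nlinarith
  have hxI : x ∈ Ioo 0 T := ⟨lt_of_le_of_ne hx.1 (Ne.symm hx0), lt_of_le_of_ne hx.2 hxT⟩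
  have hsmall : ∀ᶠ s in 𝓝[>] (0 : ℝ), s < min x (T - x) :=
    nhdsWithin_le_nhds (gt_mem_nhds (lt_min hxI.1 (sub_pos.2 hxI.2)))
  obtain ⟨s, hs1, hs2, hs3⟩ := ((hd x hxI ε hε0).and (hsmall.and self_mem_nhdsWithin)).exists
  have hs3 : 0 < s := hs3
  have ha := hmax (show x + s ∈ Icc 0 T from
    ⟨by linarith [hxI.1], by linarith [hs2.trans_le (min_le_right _ _)]⟩)
  have hb := hmax (show x - s ∈ Icc 0 T from
    ⟨by linarith [hs2.trans_le (min_le_left _ _)], by linarith [hxI.2]⟩)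
  simp only [G, mem_ofPred_eq] at ha hb
  have hlin : M * (x + s) / T + M * (x - s) / T = 2 * (M * x / T) := by ring
  nlinarith [mul_pos hε0 (pow_pos hs3 2)]

/-- Comparison principle: the averaged positive part of `f` lies below the chord determined by the
boundary values. -/
lemma integral_posPart_le_chord (hdet : v1.1 * v2.2 - v1.2 * v2.1 ≠ 0)
    {f h : ℝ × ℝ × ℝ → ℝ} (hf : ContDiff ℝ 2 f) (hh : ContDiff ℝ 2 h)
    (h1 : ∀ ξ q, h (ξ, q + v1) = h (ξ, q)) (h2 : ∀ ξ q, h (ξ, q + v2) = h (ξ, q))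
    (hpos : ∀ p, 0 < f p ↔ 0 < h p) {T M : ℝ} (hT : 0 < T) (hM : 0 ≤ M)
    (hsub : ∀ ξ ∈ Ioo 0 T, ∀ z ∈ Icc (0 : ℝ × ℝ) 1, ∀ q, q = latticePoint v1 v2 z →
      0 ≤ dirDeriv2 f (1, 0, 0) (ξ, q) + dirDeriv2 h (0, 1, 0) (ξ, q)
        + dirDeriv2 h (0, 0, 1) (ξ, q))
    (hf0 : ∀ q, f (0, q) ≤ 0) (hfT : ∀ q, f (T, q) ≤ M) {ξ : ℝ} (hξ : ξ ∈ Icc 0 T) :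
    ∫ z in Icc (0 : ℝ × ℝ) 1, max (f (ξ, latticePoint v1 v2 z)) 0 ≤ M * ξ / T := by
  have hL := continuous_latticePoint v1 v2
  have hfc := hf.continuous
  refine le_chord_of_second_difference
    (F := fun ξ => ∫ z in Icc (0 : ℝ × ℝ) 1, max (f (ξ, latticePoint v1 v2 z)) 0)
    ?_ hT ?_ ?_ ?_ hξ
  · exact continuous_parametric_integral_of_continuous
      (f := fun ξ z => max (f (ξ, latticePoint v1 v2 z)) 0) (by fun_prop) isCompact_Icc
  · simp [max_eq_right (hf0 _)]
  · have hc : Continuous fun z => max (f (T, latticePoint v1 v2 z)) 0 := by fun_prop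
    refine (integral_mono (μ := volume.restrict (Icc (0 : ℝ × ℝ) 1)) (g := fun _ => M)
      hc.integrableOn_Icc (continuous_const.integrableOn_Icc)
      fun z => max_le (hfT _) hM).trans_eq (integral_cell_const M)
  · intro x hx ε hε
    have hK : IsCompact ((fun z => (x, latticePoint v1 v2 z)) '' Icc (0 : ℝ × ℝ) 1) :=
      isCompact_Icc.image (by fun_prop)
    filter_upwards [eventually_le_second_difference hf hK (1, 0, 0) (δ := ε / 3) (by linarith),
      eventually_le_second_difference hh hK (0, 1, 0) (δ := ε / 3) (by linarith),
      eventually_le_second_difference hh hK (0, 0, 1) (δ := ε / 3) (by linarith)] with s hs1 hs2 hs3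
    refine second_difference_integral_posPart hdet hfc hh.continuous h1 h2 hpos (by positivity) ?_
    rintro z hz q rfl
    have hm := mem_image_of_mem (fun z => (x, latticePoint v1 v2 z)) hz
    have e1 := hs1 _ hm
    have e2 := hs2 _ hm
    have e3 := hs3 _ hm
    have e4 := mul_nonneg (hsub x hx z hz _ rfl) (sq_nonneg s)
    generalize latticePoint v1 v2 z = q at e1 e2 e3 e4 ⊢
    simp only [smul_eq_mul, mul_one, mul_zero, add_zero, sub_zero, Prod.add_def, Prod.sub_def,
      Prod.smul_def] at e1 e2 e3 e4 ⊢
    simp only [← sub_eq_add_neg]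
    linarith

end Comparison

section Toda

open Set Filter Topology

/-- Two functions that differ along `ξ`-slices by a dilation of `ξ` and a function of `ξ` have
spatial second derivatives that differ correspondingly. -/
lemma dirDeriv2_dilation_sub {V h : ℝ × ℝ × ℝ → ℝ} (hV : ContDiff ℝ 2 V) (hh : ContDiff ℝ 2 h)
    {l : ℝ} {κ : ℝ → ℝ} (hhV : ∀ ξ q, h (ξ, q) = V (l * ξ, q) + κ ξ - V (ξ, q))
    (ξ : ℝ) (q e : ℝ × ℝ) :
    dirDeriv2 h (0, e) (ξ, q) = dirDeriv2 V (0, e) (l * ξ, q) - dirDeriv2 V (0, e) (ξ, q) := by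
  have hc : ∀ a t : ℝ, HasDerivAt (fun t : ℝ => (a, q + t • e)) ((0 : ℝ), e) t := fun a t => by
    have := ((hasDerivAt_id t).smul_const e).const_add q
    simpa using (hasDerivAt_const t a).prodMk this
  have h1 : deriv (fun t : ℝ => h (ξ, q + t • e)) = fun t =>
      fderiv ℝ V (l * ξ, q + t • e) (0, e) - fderiv ℝ V (ξ, q + t • e) (0, e) := by
    funext t
    simp only [hhV]
    exact (((hasDerivAt_comp_line (hV.of_le (by norm_num)) (hc (l * ξ) t)).add_const _).sub
      (hasDerivAt_comp_line (hV.of_le (by norm_num)) (hc ξ t))).deriv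
  have h2 := deriv2_comp_line hh (hc ξ) 0
  rw [h1] at h2
  have h3 := h2.symm.trans
    ((hasDerivAt_comp_line (contDiff_fderiv_apply hV (0, e)) (hc (l * ξ) 0)).sub
      (hasDerivAt_comp_line (contDiff_fderiv_apply hV (0, e)) (hc ξ 0))).deriv
  simpa [dirDeriv2] using h3

lemma hasDerivAt_slice (q : ℝ × ℝ) (t : ℝ) :
    HasDerivAt (fun t : ℝ => (t, q)) ((1 : ℝ), (0 : ℝ × ℝ)) t :=
  (hasDerivAt_id t).prodMk (hasDerivAt_const t q)

/-- The second `ξ`-derivative of `l⁻² U(l ξ, q) E(ξ) - U(ξ, q)`. -/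
lemma dirDeriv2_dilation_mul_sub {U f : ℝ × ℝ × ℝ → ℝ} (hU : ContDiff ℝ 2 U)
    (hf : ContDiff ℝ 2 f) {l : ℝ} (hl : l ≠ 0) {E E₁ E₂ : ℝ → ℝ}
    (hE : ∀ t, HasDerivAt E (E₁ t) t) (hE₁ : ∀ t, HasDerivAt E₁ (E₂ t) t)
    (hfU : ∀ ξ q, f (ξ, q) = (l ^ 2)⁻¹ * (U (l * ξ, q) * E ξ) - U (ξ, q)) (ξ : ℝ) (q : ℝ × ℝ) :
    dirDeriv2 f (1, 0) (ξ, q) = E ξ * dirDeriv2 U (1, 0) (l * ξ, q)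
      + 2 * l⁻¹ * E₁ ξ * fderiv ℝ U (l * ξ, q) (1, 0) + (l ^ 2)⁻¹ * E₂ ξ * U (l * ξ, q)
      - dirDeriv2 U (1, 0) (ξ, q) := by
  have hd : ∀ t, HasDerivAt (fun t => U (t, q)) (fderiv ℝ U (t, q) (1, 0)) t := fun t =>
    hasDerivAt_comp_line (hU.of_le (by norm_num)) (hasDerivAt_slice q t)
  have hd2 : ∀ t, HasDerivAt (fun t => fderiv ℝ U (t, q) (1, 0)) (dirDeriv2 U (1, 0) (t, q)) t :=
    fun t => hasDerivAt_comp_line (contDiff_fderiv_apply hU _) (hasDerivAt_slice q t)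
  have hm : ∀ t, HasDerivAt (fun t => l * t) l t := fun t => by
    simpa using (hasDerivAt_id t).const_mul l
  have hdl : ∀ t, HasDerivAt (fun t => U (l * t, q)) (fderiv ℝ U (l * t, q) (1, 0) * l) t :=
    fun t => (hd (l * t)).comp t (hm t)
  have hd2l : ∀ t, HasDerivAt (fun t => fderiv ℝ U (l * t, q) (1, 0))
      (dirDeriv2 U (1, 0) (l * t, q) * l) t := fun t => (hd2 (l * t)).comp t (hm t)
  have h1 : deriv (fun t : ℝ => f (t, q)) = fun t =>
      (l ^ 2)⁻¹ * (fderiv ℝ U (l * t, q) (1, 0) * l * E t + U (l * t, q) * E₁ t)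
        - fderiv ℝ U (t, q) (1, 0) := by
    funext t
    simp only [hfU]
    exact ((((hdl t).mul (hE t)).const_mul _).sub (hd t)).deriv
  have h2 := deriv2_comp_line hf (hasDerivAt_slice q) ξ
  rw [h1] at h2
  rw [h2.symm.trans ((((((hd2l ξ).mul_const l).mul (hE ξ)).add
    ((hdl ξ).mul (hE₁ ξ))).const_mul _).sub (hd2 ξ)).deriv]
  field_simp
  ring

/-- Comparison of a bounded solution `V` of the Toda equation with the rescaled solution
`V(l ξ, q) - 2 log l`, corrected by a factor `E(ξ)` that makes it a subsolution. -/
lemma integral_posPart_dilation_le {v1 v2 : ℝ × ℝ} (hdet : v1.1 * v2.2 - v1.2 * v2.1 ≠ 0)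
    {V : ℝ × ℝ × ℝ → ℝ} (hV : ContDiff ℝ 2 V)
    (h1 : ∀ ξ q, V (ξ, q + v1) = V (ξ, q)) (h2 : ∀ ξ q, V (ξ, q + v2) = V (ξ, q))
    (htoda : ∀ ξ ≥ 0, ∀ q, dirDeriv2 (fun p => exp (V p)) (1, 0) (ξ, q)
      + dirDeriv2 V (0, 1, 0) (ξ, q) + dirDeriv2 V (0, 0, 1) (ξ, q) = 0)
    {l : ℝ} (hl : 0 < l) {E E₁ E₂ : ℝ → ℝ} (hEpos : ∀ t, 0 < E t) (hEc : ContDiff ℝ 2 E)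
    (hE : ∀ t, HasDerivAt E (E₁ t) t) (hE₁ : ∀ t, HasDerivAt E₁ (E₂ t) t)
    {T M : ℝ} (hT : 0 < T) (hM : 0 ≤ M)
    (hsub : ∀ ξ ∈ Ioo 0 T, ∀ z ∈ Icc (0 : ℝ × ℝ) 1, ∀ q, q = latticePoint v1 v2 z →
      0 ≤ (E ξ - 1) * dirDeriv2 (fun p => exp (V p)) (1, 0) (l * ξ, q)
        + 2 * l⁻¹ * E₁ ξ * fderiv ℝ (fun p => exp (V p)) (l * ξ, q) (1, 0)
        + (l ^ 2)⁻¹ * E₂ ξ * exp (V (l * ξ, q)))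
    (hE0 : E 0 ≤ l ^ 2)
    (hfT : ∀ q, (l ^ 2)⁻¹ * (exp (V (l * T, q)) * E T) - exp (V (T, q)) ≤ M)
    {ξ : ℝ} (hξ : ξ ∈ Icc 0 T) :
    ∫ z in Icc (0 : ℝ × ℝ) 1, max ((l ^ 2)⁻¹ * (exp (V (l * ξ, latticePoint v1 v2 z)) * E ξ)
      - exp (V (ξ, latticePoint v1 v2 z))) 0 ≤ M * ξ / T := by
  let f : ℝ × ℝ × ℝ → ℝ := fun p => (l ^ 2)⁻¹ * (exp (V (l * p.1, p.2)) * E p.1) - exp (V p)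
  let h : ℝ × ℝ × ℝ → ℝ := fun p => V (l * p.1, p.2) + (log (E p.1) - 2 * log l) - V p
  have hVl : ContDiff ℝ 2 fun p : ℝ × ℝ × ℝ => V (l * p.1, p.2) := hV.comp (by fun_prop)
  have hEf : ContDiff ℝ 2 fun p : ℝ × ℝ × ℝ => E p.1 := hEc.comp contDiff_fst
  have hU : ContDiff ℝ 2 fun p => exp (V p) := hV.exp
  have hf : ContDiff ℝ 2 f := (contDiff_const.mul (hVl.exp.mul hEf)).sub hU
  have hh : ContDiff ℝ 2 h :=
    (hVl.add ((hEf.log fun p => (hEpos _).ne').sub contDiff_const)).sub hV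
  have hpos : ∀ p, 0 < f p ↔ 0 < h p := fun p => by
    have : (l ^ 2)⁻¹ * (exp (V (l * p.1, p.2)) * E p.1) =
        exp (V (l * p.1, p.2) + (log (E p.1) - 2 * log l)) := by
      rw [exp_add, exp_sub, exp_log (hEpos _), two_mul, exp_add, exp_log hl]
      field_simp
    simp only [f, h, this, sub_pos, exp_lt_exp]
  refine integral_posPart_le_chord (f := f) (h := h) hdet hf hh (fun ξ q => by simp only [h, h1])
    (fun ξ q => by simp only [h, h2]) hpos hT hM ?_ ?_ hfT hξ
  · intro x hx z hz q hq
    have hx0 := hx.1.le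
    have e1 := dirDeriv2_dilation_mul_sub hU hf hl.ne' hE hE₁ (fun _ _ => rfl) x q
    have e2 := dirDeriv2_dilation_sub hV hh (κ := fun x => log (E x) - 2 * log l)
      (fun _ _ => rfl) x q (1, 0)
    have e3 := dirDeriv2_dilation_sub hV hh (κ := fun x => log (E x) - 2 * log l)
      (fun _ _ => rfl) x q (0, 1)
    have e4 := htoda x hx0 q
    have e5 := htoda (l * x) (mul_nonneg hl.le hx0) q
    have e6 := hsub x hx z hz q hq
    change 0 ≤ dirDeriv2 f (1, 0) (x, q) + _ + _
    rw [e1, e2, e3]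
    linarith
  · intro q
    simp only [f, mul_zero, sub_nonpos]
    rw [inv_mul_le_iff₀ (by positivity), mul_comm]
    exact mul_le_mul_of_nonneg_right hE0 (exp_pos _).le

/-- A slice of a lattice periodic function is nonpositive once the averaged positive part is. -/
lemma nonpos_of_integral_posPart_nonpos {v1 v2 : ℝ × ℝ}
    (hdet : v1.1 * v2.2 - v1.2 * v2.1 ≠ 0) {k : ℝ × ℝ → ℝ} (hk : Continuous k)
    (h1 : ∀ q, k (q + v1) = k q) (h2 : ∀ q, k (q + v2) = k q)
    (hI : ∫ z in Icc (0 : ℝ × ℝ) 1, max (k (latticePoint v1 v2 z)) 0 ≤ 0) (q : ℝ × ℝ) :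
    k q ≤ 0 :=
  max_eq_right_iff.1 <| eq_zero_of_integral_lattice_nonpos hdet (k := fun q => max (k q) 0)
    (by fun_prop) (fun q => by simp only [h1]) (fun q => by simp only [h2])
    (fun q => le_max_right _ _) hI q

lemma exp_dilation_le {v1 v2 : ℝ × ℝ} (hdet : v1.1 * v2.2 - v1.2 * v2.1 ≠ 0)
    {V : ℝ × ℝ × ℝ → ℝ} (hV : ContDiff ℝ 2 V)
    (h1 : ∀ ξ q, V (ξ, q + v1) = V (ξ, q)) (h2 : ∀ ξ q, V (ξ, q + v2) = V (ξ, q))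
    (htoda : ∀ ξ ≥ 0, ∀ q, dirDeriv2 (fun p => exp (V p)) (1, 0) (ξ, q)
      + dirDeriv2 V (0, 1, 0) (ξ, q) + dirDeriv2 V (0, 0, 1) (ξ, q) = 0)
    {B : ℝ} (hB : ∀ ξ ≥ 0, ∀ q, |V (ξ, q)| ≤ B) {l : ℝ} (hl : 1 ≤ l)
    {ξ : ℝ} (hξ : 0 ≤ ξ) (q : ℝ × ℝ) :
    (l ^ 2)⁻¹ * exp (V (l * ξ, q)) ≤ exp (V (ξ, q)) := by
  have hl0 : 0 < l := by linarith
  have hVc := hV.continuous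
  have hl2 : 1 ≤ l ^ 2 := one_le_pow₀ hl
  refine sub_nonpos.1 (nonpos_of_integral_posPart_nonpos hdet
    (k := fun q => (l ^ 2)⁻¹ * exp (V (l * ξ, q)) - exp (V (ξ, q))) (by fun_prop)
    (fun q => by simp only [h1]) (fun q => by simp only [h2]) ?_ q)
  have hlim : Tendsto (fun T : ℝ => exp B * ξ / T) atTop (𝓝 0) :=
    tendsto_const_nhds.div_atTop tendsto_id
  refine ge_of_tendsto hlim ?_
  filter_upwards [eventually_ge_atTop (ξ + 1)] with T hT
  have := integral_posPart_dilation_le hdet hV h1 h2 htoda hl0 (E := fun _ => 1)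
    (E₁ := fun _ => 0) (E₂ := fun _ => 0) (fun _ => one_pos) contDiff_const
    (fun t => hasDerivAt_const t _) (fun t => hasDerivAt_const t _) (T := T) (M := exp B)
    (by linarith) (exp_pos _).le (by simp) hl2 (fun q => ?_) (ξ := ξ) ⟨hξ, by linarith⟩
  · simpa only [mul_one] using this
  · have hb : exp (V (l * T, q)) ≤ exp B :=
      exp_le_exp.2 ((le_abs_self _).trans (hB _ (mul_nonneg hl0.le (by linarith)) q))
    have : (l ^ 2)⁻¹ * (exp (V (l * T, q)) * 1) ≤ 1 * exp B := by
      rw [mul_one]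
      exact mul_le_mul (inv_le_one_of_one_le₀ hl2) hb (exp_pos _).le zero_le_one
    linarith [exp_pos (V (T, q))]

/-- The comparison with the rescaled solution improves, on `[0, T]`, by a factor that exceeds `1`
by a multiple of `l² - 1`. -/
lemma exists_exp_dilation_mul_le {v1 v2 : ℝ × ℝ} (hdet : v1.1 * v2.2 - v1.2 * v2.1 ≠ 0)
    {V : ℝ × ℝ × ℝ → ℝ} (hV : ContDiff ℝ 2 V)
    (h1 : ∀ ξ q, V (ξ, q + v1) = V (ξ, q)) (h2 : ∀ ξ q, V (ξ, q + v2) = V (ξ, q))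
    (htoda : ∀ ξ ≥ 0, ∀ q, dirDeriv2 (fun p => exp (V p)) (1, 0) (ξ, q)
      + dirDeriv2 V (0, 1, 0) (ξ, q) + dirDeriv2 V (0, 0, 1) (ξ, q) = 0)
    {B : ℝ} (hB : ∀ ξ ≥ 0, ∀ q, |V (ξ, q)| ≤ B) {T : ℝ} (hT : 0 < T) :
    ∃ K > 0, ∀ l, 1 ≤ l → l ^ 2 ≤ 2 → ∀ ξ ∈ Icc 0 T, ∀ q,
      exp (V (l * ξ, q)) * (1 + (l ^ 2 - 1) * (exp (-K * ξ) - exp (-K * T)))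
        ≤ l ^ 2 * exp (V (ξ, q)) := by
  have hU : ContDiff ℝ 2 fun p => exp (V p) := hV.exp
  have hVc := hV.continuous
  have hcpt : IsCompact (Icc (0 : ℝ) (2 * T) ×ˢ (latticePoint v1 v2 '' Icc (0 : ℝ × ℝ) 1)) :=
    isCompact_Icc.prod (isCompact_Icc.image (continuous_latticePoint v1 v2))
  obtain ⟨C₁, hC₁⟩ := hcpt.exists_bound_of_continuousOn
    ((contDiff_fderiv_apply hU ((1 : ℝ), (0 : ℝ × ℝ))).continuous.continuousOn)
  obtain ⟨C₂, hC₂⟩ := hcpt.exists_bound_of_continuousOn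
    ((continuous_dirDeriv2 hU ((1 : ℝ), (0 : ℝ × ℝ))).continuousOn)
  set C := max (max C₁ C₂) 0 with hC
  have hC0 : 0 ≤ C := le_max_right _ _
  set K := 1 + 6 * C / exp (-B) with hK
  have hK1 : 1 ≤ K := le_add_of_nonneg_right (by positivity)
  have hK6 : 6 * C ≤ K * exp (-B) := by
    rw [hK, add_mul, div_mul_cancel₀ _ (exp_pos _).ne']
    linarith [exp_pos (-B)]
  refine ⟨K, by linarith, fun l hl hl2 ξ hξ q => ?_⟩
  have hl0 : 0 < l := by linarith
  have hl1 : 1 ≤ l ^ 2 := one_le_pow₀ hl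
  have hl2' : l ≤ 2 := by nlinarith
  set η := l ^ 2 - 1 with hη
  have hη0 : 0 ≤ η := by linarith
  have hKT : exp (-K * T) < 1 := Real.exp_lt_one_iff.2 (by nlinarith)
  have hexp : ∀ t, HasDerivAt (fun t => exp (-K * t)) (exp (-K * t) * -K) t := fun t => by
    simpa using ((hasDerivAt_id t).const_mul (-K)).exp
  have hEpos : ∀ t, 0 < 1 + η * (exp (-K * t) - exp (-K * T)) := fun t => by
    nlinarith [exp_pos (-K * t), exp_pos (-K * T), mul_nonneg hη0 (exp_pos (-K * t)).le,
      mul_nonneg (show 0 ≤ 1 - η by linarith) (exp_pos (-K * T)).le]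
  have := integral_posPart_dilation_le hdet hV h1 h2 htoda hl0
    (E := fun t => 1 + η * (exp (-K * t) - exp (-K * T)))
    (E₁ := fun t => η * (exp (-K * t) * -K)) (E₂ := fun t => η * (exp (-K * t) * -K * -K))
    hEpos (by fun_prop) (fun t => (((hexp t).sub_const _).const_mul _).const_add _)
    (fun t => ((hexp t).mul_const _).const_mul _) hT le_rfl ?_ ?_ ?_ hξ
  · rw [zero_mul, zero_div] at this
    have := nonpos_of_integral_posPart_nonpos hdet (k := fun q => (l ^ 2)⁻¹ * (exp (V (l * ξ, q))
      * (1 + η * (exp (-K * ξ) - exp (-K * T)))) - exp (V (ξ, q))) (by fun_prop)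
      (fun q => by simp only [h1]) (fun q => by simp only [h2]) this q
    rwa [sub_nonpos, inv_mul_le_iff₀ (by positivity)] at this
  · intro x hx z hz q hq
    have hmem : (l * x, q) ∈ Icc (0 : ℝ) (2 * T) ×ˢ (latticePoint v1 v2 '' Icc (0 : ℝ × ℝ) 1) :=
      ⟨⟨mul_nonneg hl0.le hx.1.le, mul_le_mul hl2' hx.2.le hx.1.le zero_le_two⟩, z, hz, hq.symm⟩
    have b1 := (hC₁ _ hmem).trans ((le_max_left C₁ C₂).trans (le_max_left _ 0))
    have b2 := (hC₂ _ hmem).trans ((le_max_right C₁ C₂).trans (le_max_left _ 0))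
    have b3 : exp (-B) ≤ exp (V (l * x, q)) :=
      exp_le_exp.2 (abs_le.1 (hB _ (mul_nonneg hl0.le hx.1.le) q)).1
    rw [Real.norm_eq_abs, ← hC] at b1 b2
    generalize fderiv ℝ (fun p => exp (V p)) (l * x, q) (1, 0) = P at b1 ⊢
    generalize dirDeriv2 (fun p => exp (V p)) (1, 0) (l * x, q) = R at b2 ⊢
    generalize exp (V (l * x, q)) = U at b3 ⊢
    have hw : exp (-K * T) ≤ exp (-K * x) := exp_le_exp.2 (by nlinarith [hx.2])
    have hwT := exp_pos (-K * T)
    have hw0 := exp_pos (-K * x)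
    have hm := exp_pos (-B)
    generalize exp (-K * T) = wT at hw hwT ⊢
    generalize exp (-K * x) = w at hw hw0 ⊢
    generalize exp (-B) = m at hm hK6 b3
    have hinv : l⁻¹ ≤ 1 := inv_le_one_of_one_le₀ hl
    have hinv0 : 0 < l⁻¹ := inv_pos.2 hl0
    have hinv2 : 1 / 2 ≤ (l ^ 2)⁻¹ := by
      rw [one_div]; exact inv_anti₀ (by positivity) hl2
    have t1 : -(w * C) ≤ (w - wT) * R := by
      have : |(w - wT) * R| ≤ w * C := by
        rw [abs_mul, abs_of_nonneg (sub_nonneg.2 hw)]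
        exact mul_le_mul (by linarith) b2 (abs_nonneg _) hw0.le
      exact (abs_le.1 this).1
    have t2 : -(w * (2 * K * C)) ≤ w * (2 * K * (l⁻¹ * -P)) := by
      have : |l⁻¹ * -P| ≤ 1 * C := by
        rw [abs_mul, abs_neg, abs_of_pos hinv0]
        exact mul_le_mul hinv b1 (abs_nonneg _) zero_le_one
      have := (abs_le.1 this).1
      rw [← mul_neg]
      gcongr
      rw [← mul_neg]
      gcongr
      linarith
    have t3 : w * (K ^ 2 * (1 / 2 * m)) ≤ w * (K ^ 2 * ((l ^ 2)⁻¹ * U)) := by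
      gcongr
    have t4 : 0 ≤ w * (K ^ 2 * (1 / 2 * m) - 2 * K * C - C) := by
      refine mul_nonneg hw0.le ?_
      nlinarith [mul_le_mul_of_nonneg_left hK6 (show 0 ≤ K by linarith)]
    have t5 : 0 ≤ η * ((w - wT) * R + w * (2 * K * (l⁻¹ * -P))
        + w * (K ^ 2 * ((l ^ 2)⁻¹ * U))) := mul_nonneg hη0 (by linarith)
    linarith
  · have : exp (-K * 0) - exp (-K * T) ≤ 1 := by
      simp [(exp_pos _).le]
    nlinarith
  · intro q
    simp only [sub_self, mul_zero, add_zero, mul_one, sub_nonpos]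
    exact exp_dilation_le hdet hV h1 h2 htoda hB hl hT.le q

/-- A quantitative lower bound for `W` on `[0, T]`. -/
lemma exp_sub_exp_le_toda_weight {g : ℝ → ℝ} {g' ξ ψ : ℝ} (hg : HasDerivAt g g' ξ)
    (h : ∀ l, 1 ≤ l → l ^ 2 ≤ 2 → exp (g (l * ξ)) * (1 + (l ^ 2 - 1) * ψ) ≤ l ^ 2 * exp (g ξ)) :
    ψ ≤ 1 - (1 / 2) * ξ * g' := by
  have hm : HasDerivAt (fun l : ℝ => l * ξ) ξ 1 := by
    simpa using (hasDerivAt_id (1 : ℝ)).mul_const ξ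
  have hg1 : HasDerivAt (fun l => exp (g (l * ξ))) (exp (g ξ) * (g' * ξ)) 1 := by
    have hg' : HasDerivAt g g' (1 * ξ) := by rwa [one_mul]
    simpa using (HasDerivAt.comp (1 : ℝ) hg' hm).exp
  have hsq : HasDerivAt (fun l : ℝ => l ^ 2) 2 1 := by simpa using hasDerivAt_pow 2 (1 : ℝ)
  have hR : HasDerivAt
      (fun l => exp (g (l * ξ)) * (1 + (l ^ 2 - 1) * ψ) - l ^ 2 * exp (g ξ))
      (exp (g ξ) * (g' * ξ + 2 * ψ - 2)) 1 := by
    refine ((hg1.mul (((hsq.sub_const 1).mul_const ψ).const_add 1)).sub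
      (hsq.mul_const _)).congr_deriv ?_
    simp only [one_mul, one_pow, sub_self, zero_mul, add_zero, mul_one]
    ring
  have hle : exp (g ξ) * (g' * ξ + 2 * ψ - 2) ≤ 0 := by
    have hs := (hasDerivWithinAt_iff_tendsto_slope' (s := Ioi 1) (by simp)).1 hR.hasDerivWithinAt
    refine le_of_tendsto hs ?_
    have h2 : ∀ᶠ l : ℝ in 𝓝[>] 1, l ^ 2 < 2 :=
      nhdsWithin_le_nhds (hsq.continuousAt.eventually_lt_const (by norm_num))
    filter_upwards [h2, self_mem_nhdsWithin] with l hl hl1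
    have hl1 : 1 < l := hl1
    rw [slope_def_field]
    refine div_nonpos_of_nonpos_of_nonneg ?_ (by linarith)
    have := h l hl1.le hl.le
    simp only [one_mul, one_pow, sub_self, zero_mul, add_zero, mul_one]
    linarith
  have := nonpos_of_mul_nonpos_right hle (exp_pos _)
  linarith

end Toda

/-- Positivity of `W = 1 − (1/2)ξ v_ξ` for solutions of BVP1. -/
theorem stmt6
    (v1 v2 : ℝ × ℝ) (hdet : |v1.1 * v2.2 - v1.2 * v2.1| = 1)
    (φ : ℝ → ℝ → ℝ)
    (hφreg : ContDiff ℝ (⊤ : ℕ∞) (fun p : ℝ × ℝ => φ p.1 p.2))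
    (hφper : LatticePeriodic v1 v2 φ)
    (v : ℝ → ℝ → ℝ → ℝ) (hv : IsSolBVP1 v1 v2 φ v) :
    ∀ ξ ≥ (0:ℝ), ∀ x y : ℝ,
      0 < 1 - (1/2) * ξ * deriv (fun s => v s x y) ξ := by
  obtain ⟨hV, ⟨B, hB⟩, hper, -, htoda⟩ := hv
  intro ξ hξ x y
  have hdet' : v1.1 * v2.2 - v1.2 * v2.1 ≠ 0 := fun h => by simp [h] at hdet
  have hU : ContDiff ℝ 2 fun p : ℝ × ℝ × ℝ => exp (v p.1 p.2.1 p.2.2) := hV.exp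
  have htoda' : ∀ ξ ≥ 0, ∀ q : ℝ × ℝ,
      dirDeriv2 (fun p : ℝ × ℝ × ℝ => exp (v p.1 p.2.1 p.2.2)) (1, 0) (ξ, q)
      + dirDeriv2 (fun p : ℝ × ℝ × ℝ => v p.1 p.2.1 p.2.2) (0, 1, 0) (ξ, q)
      + dirDeriv2 (fun p : ℝ × ℝ × ℝ => v p.1 p.2.1 p.2.2) (0, 0, 1) (ξ, q) = 0 := by
    rintro ξ hξ ⟨x, y⟩
    refine Eq.trans ?_ (htoda ξ hξ x y)
    rw [todaOp, ← deriv2_comp_line hU (hasDerivAt_slice (x, y)) ξ,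
      ← deriv2_comp_line hV (c := fun t => (ξ, t, y)) (fun t =>
        (hasDerivAt_const t ξ).prodMk ((hasDerivAt_id t).prodMk (hasDerivAt_const t y))) x,
      ← deriv2_comp_line hV (c := fun t => (ξ, x, t)) (fun t =>
        (hasDerivAt_const t ξ).prodMk ((hasDerivAt_const t x).prodMk (hasDerivAt_id t))) y]
  obtain ⟨K, hK, hle⟩ := exists_exp_dilation_mul_le hdet' hV
    (fun ξ q => (hper ξ q.1 q.2).1) (fun ξ q => (hper ξ q.1 q.2).2) htoda'
    (fun ξ hξ q => hB ξ hξ q.1 q.2) (show 0 < ξ + 1 by linarith)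
  have hd : DifferentiableAt ℝ (fun s => v s x y) ξ :=
    (hasDerivAt_comp_line (hV.of_le (by norm_num)) (hasDerivAt_slice (x, y) ξ)).differentiableAt
  refine lt_of_lt_of_le ?_ (exp_sub_exp_le_toda_weight hd.hasDerivAt
    (fun l hl hl2 => hle l hl hl2 ξ ⟨hξ, by linarith⟩ (x, y)))
  exact sub_pos.2 (exp_lt_exp.2 (by linarith))
end
end
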